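/- Hook length formula for d-complete posets (Proctor): the number of linear extensions of a d-complete poset P with n elements equals n! / Π_{p∈P} (Σ_{D} h_P^{(D)}(p)), where the sum in each factor is over all diagonals D of P. -/

import Mathlib

variable {P : Type*} [PartialOrder P]

/-- A subset `S` of a poset is convex if it contains every element lying
between two of its elements. -/
def IsConvexSet (S : Set P) : Prop :=
  ∀ a ∈ S, ∀ b ∈ S, ∀ x, a ≤ x → x ≤ b → x ∈ S

/-- `S` has the structure of (an order ideal of) `d_k(1)` with side elements `w`, `z`:
`w` and `z` are incomparable, every other element of `S` lies below both or above
both of them, the elements below them (the tail) form a chain of `k - 2` elements,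
and the elements above them (the neck) form a chain. -/
def DkStruct (k : ℕ) (S : Set P) (w z : P) : Prop :=
  3 ≤ k ∧ w ∈ S ∧ z ∈ S ∧ ¬ w ≤ z ∧ ¬ z ≤ w ∧
  (∀ x ∈ S, x = w ∨ x = z ∨ (x ≤ w ∧ x ≤ z) ∨ (w ≤ x ∧ z ≤ x)) ∧
  IsChain (· ≤ ·) {x ∈ S | x ≤ w ∧ x ≤ z} ∧
  IsChain (· ≤ ·) {x ∈ S | w ≤ x ∧ z ≤ x} ∧
  {x ∈ S | x ≤ w ∧ x ≤ z}.ncard = k - 2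

/-- The interval `[a, b]` is a `d_k`-interval (isomorphic to `d_k(1)`)
with side elements `w` and `z`. -/
def IsDkIntervalWith (k : ℕ) (a b w z : P) : Prop :=
  a ≤ b ∧ DkStruct k (Set.Icc a b) w z ∧
    {x ∈ Set.Icc a b | w ≤ x ∧ z ≤ x}.ncard = k - 2

/-- The interval `[a, b]` is a `d_k`-interval. -/
def IsDkInterval (k : ℕ) (a b : P) : Prop := ∃ w z, IsDkIntervalWith k a b w z

/-- The interval `[a, b]` is a `d`-interval. -/
def IsDInterval (a b : P) : Prop := ∃ k, IsDkInterval k a b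

/-- The interval `[a, b]` is a `d`-interval with side elements `w` and `z`. -/
def IsDIntervalWith (a b w z : P) : Prop := ∃ k, IsDkIntervalWith k a b w z

/-- `p` is a neck element of the `d`-interval `[a, b]`. -/
def IsNeckOf (p a b : P) : Prop :=
  ∃ k w z, IsDkIntervalWith k a b w z ∧ p ∈ Set.Icc a b ∧ w ≤ p ∧ z ≤ p

/-- `p` is a tail element of the `d`-interval `[a, b]`. -/
def IsTailOf (p a b : P) : Prop :=
  ∃ k w z, IsDkIntervalWith k a b w z ∧ p ∈ Set.Icc a b ∧ p ≤ w ∧ p ≤ z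

/-- `S` is a `d_k^-`-convex set: a convex subset isomorphic to `d_k(1)` minus
its maximum (so the neck has `k - 3` elements). -/
def IsDkMinusConvex (k : ℕ) (S : Set P) : Prop :=
  IsConvexSet S ∧ ∃ w z, DkStruct k S w z ∧
    {x ∈ S | w ≤ x ∧ z ≤ x}.ncard = k - 3

/-- Proctor's axioms for a d-complete poset:
(1) every `d_k^-`-convex set can be completed above to a `d_k`-interval;
(2) the maximum of any `d`-interval covers no element outside the interval;
(3) no two `d^-`-convex sets differ only in their minimal elements. -/
def IsDComplete (P : Type*) [PartialOrder P] : Prop :=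
  (∀ (k : ℕ) (S : Set P), IsDkMinusConvex k S →
      ∃ z, z ∉ S ∧ ∃ a, IsDkInterval k a z ∧ Set.Icc a z = insert z S) ∧
  (∀ a b : P, IsDInterval a b → ∀ x, x ⋖ b → x ∈ Set.Icc a b) ∧
  (∀ (k k' : ℕ) (S T : Set P), IsDkMinusConvex k S → IsDkMinusConvex k' T →
      ∀ s ∈ S, ∀ t ∈ T, (∀ x ∈ S, s ≤ x) → (∀ x ∈ T, t ≤ x) →
        S \ {s} = T \ {t} → S = T)

/-- Two elements are in the same diagonal: the equivalence relation generated by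
`p ∼ q` whenever `[p, q]` is a `d`-interval. -/
def DiagRel {P : Type*} [PartialOrder P] (a b : P) : Prop :=
  Relation.EqvGen (fun x y => IsDInterval x y) a b

/-- The setoid on `P` whose classes are the diagonals. -/
def diagSetoid (P : Type*) [PartialOrder P] : Setoid P :=
  ⟨DiagRel, Relation.EqvGen.is_equivalence _⟩

/-- `h` is the hook-vector function of the d-complete poset `P`, indexed by
diagonals (the quotient of `P` by `DiagRel`): if `p` is not a neck element of any
`d`-interval then `h p D` counts the elements of the diagonal `D` weakly below `p`;
and if `[p', p]` is a `d`-interval with side elements `w`, `z`, then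
`h p = h w + h z - h p'`. -/
def IsHookVector {P : Type*} [PartialOrder P]
    (h : P → Quotient (diagSetoid P) → ℤ) : Prop :=
  (∀ p : P, (¬ ∃ a b : P, IsNeckOf p a b) → ∀ D,
      h p D = ({r : P | Quotient.mk (diagSetoid P) r = D ∧ r ≤ p}).ncard) ∧
  (∀ p' p w z : P, IsDIntervalWith p' p w z → ∀ D,
      h p D = h w D + h z D - h p' D)

/-- A linear extension of `P`, as an enumeration `e 0 > e 1 > ⋯` refining the
partial order: each initial segment is an upper set. -/
def IsLinExt {P : Type*} [PartialOrder P] [Fintype P]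
    (e : Fin (Fintype.card P) ≃ P) : Prop :=
  ∀ i j, e i < e j → j < i

open scoped Classical

structure DHeap {P D : Type*} [PartialOrder P] [Fintype P] (c : P → D) (a : D → D → ℤ)
    (lam : D → ℤ) : Prop where
  symm : ∀ i j, a i j = a j i
  diag : ∀ i, a i i = 2
  off : ∀ i j, i ≠ j → a i j = 0 ∨ a i j = -1
  comp : ∀ x y, a (c x) (c y) ≠ 0 → x ≤ y ∨ y ≤ x
  cov : ∀ x y, x ⋖ y → a (c x) (c y) = -1
  K : ∀ p, lam (c p) = 1 + ∑ q with p < q, a (c q) (c p)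
  nonneg : ∀ i, 0 ≤ lam i

namespace DHeap
variable {P D : Type*} [PartialOrder P] [Fintype P] {c : P → D} {a : D → D → ℤ} {lam : D → ℤ}

theorem nonpos (H : DHeap c a lam) {i j : D} (h : i ≠ j) : a i j ≤ 0 := by
  rcases H.off i j h with h | h <;> omega

theorem cne (H : DHeap c a lam) {x y : P} (h : x ⋖ y) : c x ≠ c y := by
  intro e
  have := H.cov x y h
  rw [e, H.diag] at this
  omega

/-- sum over comparable elements -/
theorem exists_cov_le {x y : P} (h : x < y) : ∃ z, x ⋖ z ∧ z ≤ y := by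
  have := exists_covBy_le_of_lt h
  exact this

theorem exists_le_cov {x y : P} (h : x < y) : ∃ z, x ≤ z ∧ z ⋖ y := by
  have := exists_le_covBy_of_lt h
  exact this

theorem delta (H : DHeap c a lam) (G : Finset P) (hne : G.Nonempty)
    (hconv : ∀ x ∈ G, ∀ y ∈ G, ∀ z, x ≤ z → z ≤ y → z ∈ G) :
    ∃ s ∈ G, 1 ≤ ∑ y ∈ G, a (c y) (c s) := by
  by_contra hcon
  push Not at hcon
  have hle : ∀ s ∈ G, ∑ y ∈ G, a (c y) (c s) ≤ 0 := fun s hs => by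
    have := hcon s hs; omega
  set F : Finset P := Finset.univ.filter (fun x => (∃ g ∈ G, g ≤ x) ∧ x ∉ G) with hF
  have hFup : ∀ x ∈ F, ∀ y, x ≤ y → y ∈ F := by
    intro x hx y hxy
    simp only [hF, Finset.mem_filter, Finset.mem_univ, true_and] at hx ⊢
    obtain ⟨⟨g, hg, hgx⟩, hxG⟩ := hx
    exact ⟨⟨g, hg, hgx.trans hxy⟩, fun hy => hxG (hconv g hg y hy x hgx hxy)⟩
  -- K for s in G
  have hK : ∀ s ∈ G, lam (c s) = 1 + ∑ y ∈ G, (if s < y then a (c y) (c s) else 0)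
      + ∑ y ∈ F, a (c y) (c s) := by
    intro s hs
    rw [H.K s, add_assoc]
    congr 1
    rw [Finset.sum_filter, ← Finset.sum_subset (Finset.subset_univ (G ∪ F)),
      Finset.sum_union]
    · congr 1
      refine Finset.sum_congr rfl fun y hy => ?_
      split_ifs with h
      · rfl
      · by_contra h0
        rcases H.comp y s (Ne.symm h0) with h1 | h1
        · have := hFup y hy s h1
          simp [hF] at this
          exact this.2 hs
        · rcases h1.lt_or_eq with h2 | h2
          · exact h h2
          · subst h2
            simp [hF] at hy
            exact hy.2 hs
    · rw [Finset.disjoint_left]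
      intro x hx hx'
      simp [hF] at hx'
      exact hx'.2 hx
    · intro y _ hy
      rw [if_neg]
      intro h
      apply hy
      simp only [Finset.mem_union, hF, Finset.mem_filter, Finset.mem_univ, true_and]
      by_cases hyG : y ∈ G
      · exact Or.inl hyG
      · exact Or.inr ⟨⟨s, hs, h.le⟩, hyG⟩
  have hhalf : 2 * ∑ s ∈ G, ∑ y ∈ G, (if s < y then a (c y) (c s) else 0) + 2 * (G.card : ℤ)
      = ∑ s ∈ G, ∑ y ∈ G, a (c y) (c s) := by
    have h1 : ∑ s ∈ G, ∑ y ∈ G, (if s < y then a (c y) (c s) else 0)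
        = ∑ s ∈ G, ∑ y ∈ G, (if y < s then a (c y) (c s) else 0) := by
      rw [Finset.sum_comm]
      refine Finset.sum_congr rfl fun s _ => Finset.sum_congr rfl fun y _ => ?_
      rw [H.symm]
    have h2 : ∀ s ∈ G, ∑ y ∈ G, a (c y) (c s) =
        ∑ y ∈ G, (if s < y then a (c y) (c s) else 0) +
        ∑ y ∈ G, (if y < s then a (c y) (c s) else 0) + ∑ y ∈ G, (if y = s then 2 else 0) := by
      intro s hs
      rw [← Finset.sum_add_distrib, ← Finset.sum_add_distrib]
      refine Finset.sum_congr rfl fun y hy => ?_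
      by_cases h : y = s
      · subst h; simp [H.diag]
      · by_cases h0 : a (c y) (c s) = 0
        · simp [h0, h]
        · rcases H.comp y s h0 with h3 | h3
          · have h4 := lt_of_le_of_ne h3 h
            simp [h4, h, h4.not_gt]
          · have h4 := lt_of_le_of_ne h3 (Ne.symm h)
            simp [h4, h, h4.not_gt]
    rw [Finset.sum_congr rfl h2, Finset.sum_add_distrib, Finset.sum_add_distrib, ← h1]
    have : ∑ s ∈ G, ∑ y ∈ G, (if y = s then (2:ℤ) else 0) = 2 * G.card := by
      rw [Finset.sum_congr rfl (fun s hs => by rw [Finset.sum_ite_eq' G s]; simp only [hs, if_true] : ∀ s ∈ G, _ = (2:ℤ))]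
      simp [mul_comm]
    rw [this]; ring
  have hsum : ∑ s ∈ G, lam (c s) = (G.card : ℤ)
      + ∑ s ∈ G, ∑ y ∈ G, (if s < y then a (c y) (c s) else 0)
      + ∑ y ∈ F, ∑ s ∈ G, a (c y) (c s) := by
    rw [Finset.sum_congr rfl hK, Finset.sum_add_distrib, Finset.sum_add_distrib]
    rw [Finset.sum_comm (s := G) (t := F)]
    simp
  have hFle : ∀ y ∈ F, ∑ s ∈ G, a (c y) (c s) ≤ 0 := by
    intro y hy
    by_cases h : ∃ s ∈ G, c s = c y
    · obtain ⟨s, hs, h⟩ := h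
      have := hle s hs
      rw [← h]
      refine le_trans (le_of_eq ?_) this
      exact Finset.sum_congr rfl fun t _ => H.symm _ _
    · push Not at h
      exact Finset.sum_nonpos fun s hs => H.nonpos (h s hs).symm
  have hGle : ∑ s ∈ G, ∑ y ∈ G, a (c y) (c s) ≤ 0 := Finset.sum_nonpos hle
  have hlam0 : 0 ≤ ∑ s ∈ G, lam (c s) := Finset.sum_nonneg fun s _ => H.nonneg _
  have hF0 : ∑ y ∈ F, ∑ s ∈ G, a (c y) (c s) ≤ 0 := Finset.sum_nonpos hFle
  have e1 : ∑ s ∈ G, lam (c s) = 0 := by linarith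
  have e2 : ∑ y ∈ F, ∑ s ∈ G, a (c y) (c s) = 0 := by linarith
  rw [Finset.sum_eq_zero_iff_of_nonneg (fun s _ => H.nonneg _)] at e1
  rw [Finset.sum_eq_zero_iff_of_nonpos hFle] at e2
  obtain ⟨g, hg⟩ := hne
  have hcol : ∀ x : P, g ≤ x → ∃ s ∈ G, c s = c x := by
    intro x
    induction x using WellFoundedLT.induction with
    | ind x ih =>
      intro hgx
      by_cases hx : x ∈ G
      · exact ⟨x, hx, rfl⟩
      have hlt : g < x := lt_of_le_of_ne hgx (by rintro rfl; exact hx hg)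
      obtain ⟨x', h1, h2⟩ := exists_le_cov hlt
      obtain ⟨s', hs', hc⟩ := ih x' h2.lt h1
      have hxF : x ∈ F := by
        simp only [hF, Finset.mem_filter, Finset.mem_univ, true_and]
        exact ⟨⟨g, hg, hgx⟩, hx⟩
      have := e2 x hxF
      by_contra hno
      push Not at hno
      have hlt : ∑ s ∈ G, a (c x) (c s) < 0 := by
        refine Finset.sum_neg' (fun s hs => H.nonpos (hno s hs).symm) ⟨s', hs', ?_⟩
        rw [hc, H.symm, H.cov _ _ h2]; norm_num
      omega
  obtain ⟨T, hgT, hT⟩ := (Set.toFinite (Set.univ : Set P)).exists_le_maximal (Set.mem_univ g)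
  obtain ⟨s, hs, hc⟩ := hcol T hgT
  have h1 := H.K T
  rw [Finset.sum_eq_zero, ← hc, e1 s hs] at h1
  · omega
  · intro q hq
    simp at hq
    exact absurd (hT.2 (Set.mem_univ q) hq.le) hq.not_ge
end DHeap

namespace DHeap
variable {P D : Type*} [PartialOrder P] [Fintype P] {c : P → D} {a : D → D → ℤ} {lam : D → ℤ}

theorem star (H : DHeap c a lam) : ∀ (n : ℕ) (r p : P),
    (Finset.univ.filter (fun x => r ≤ x ∧ x ≤ p)).card = n → r < p →
    (∀ s, r ≤ s → s < p → c s ≠ c p) →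
    ∑ s with (r < s ∧ s ≤ p), a (c s) (c r) = -1 := by
  intro n
  induction n using Nat.strong_induction_on with
  | _ n ih =>
  intro r p hn hrp hcol
  have ih1 : ∀ s, r < s → s < p → ∑ y with (s < y ∧ y ≤ p), a (c y) (c s) = -1 := by
    intro s hrs hsp
    refine ih _ ?_ s p rfl hsp (fun t h1 h2 => hcol t (hrs.le.trans h1) h2)
    rw [← hn]
    apply Finset.card_lt_card
    rw [Finset.ssubset_iff_of_subset]
    · refine ⟨r, by simp [hrp.le], by simp [hrs.not_ge]⟩
    · intro x; simp only [Finset.mem_filter, Finset.mem_univ, true_and]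
      exact fun h => ⟨hrs.le.trans h.1, h.2⟩
  by_cases hex : ∃ r', r < r' ∧ r' ≤ p ∧ c r' = c r
  · obtain ⟨r', h1, h2, h3⟩ := hex
    have hlt : r' < p := lt_of_le_of_ne h2 (by
      rintro rfl; exact hcol r le_rfl hrp h3.symm)
    have e1 := ih1 r' h1 hlt
    rw [h3] at e1
    have e2 : ∑ q with r < q, a (c q) (c r) = ∑ q with r' < q, a (c q) (c r) := by
      have k1 := H.K r
      have k2 := H.K r'
      rw [h3] at k2; linarith
    have e2' : ∑ s, ((if r < s then a (c s) (c r) else 0)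
        - (if r' < s then a (c s) (c r) else 0)) = 0 := by
      rw [Finset.sum_sub_distrib, ← Finset.sum_filter, ← Finset.sum_filter, e2, sub_self]
    rw [← e1, ← sub_eq_zero, Finset.sum_filter, Finset.sum_filter, ← Finset.sum_sub_distrib]
    refine Eq.trans (Finset.sum_congr rfl fun s _ => ?_) e2'
    by_cases h0 : a (c s) (c r) = 0
    · simp [h0]
    by_cases hs : r' < s
    · simp [hs, h1.trans hs]
    · rw [← h3] at h0
      have : s ≤ r' := by
        rcases H.comp _ _ h0 with h | h
        · exact h
        · rcases h.lt_or_eq with h | h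
          · exact absurd h hs
          · exact h.ge
      simp [hs, this.trans h2]
  · push Not at hex
    have hterm : ∀ s, r < s → s ≤ p → a (c s) (c r) ≤ 0 := fun s h1 h2 =>
      H.nonpos (hex s h1 h2)
    have hle : ∑ s with (r < s ∧ s ≤ p), a (c s) (c r) < 0 := by
      obtain ⟨z, hz1, hz2⟩ := exists_cov_le hrp
      refine Finset.sum_neg' ?_ ⟨z, by simp [hz1.lt, hz2], ?_⟩
      · intro s hs; simp at hs; exact hterm s hs.1 hs.2
      · rw [H.symm, H.cov _ _ hz1]; norm_num
    by_contra hne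
    have hle2 : ∑ s with (r < s ∧ s ≤ p), a (c s) (c r) ≤ -2 := by omega
    obtain ⟨s, hs, hs1⟩ := H.delta (Finset.univ.filter (fun x => r ≤ x ∧ x ≤ p))
      ⟨r, by simp [hrp.le]⟩ (by
        intro x hx y hy z hxz hzy
        simp at hx hy ⊢
        exact ⟨hx.1.trans hxz, hzy.trans hy.2⟩)
    simp only [Finset.mem_filter, Finset.mem_univ, true_and] at hs
    -- take the lowest of the color
    obtain ⟨t, ht⟩ := (Set.toFinite {t : P | (r ≤ t ∧ t ≤ p) ∧ c t = c s}).exists_minimal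
      ⟨s, hs, rfl⟩
    obtain ⟨⟨⟨ht1, ht2⟩, ht3⟩, htmin⟩ := ht
    rw [← ht3] at hs1
    have hlow : ∀ y, r ≤ y → y < t → c y ≠ c t := by
      intro y h1 h2 h3
      exact h2.not_ge (htmin ⟨⟨h1, h2.le.trans ht2⟩, h3.trans ht3⟩ h2.le)
    have hsplit : ∑ y with (r ≤ y ∧ y ≤ p), a (c y) (c t) = 2 +
        ∑ y with (t < y ∧ y ≤ p), a (c y) (c t) + ∑ y with (r ≤ y ∧ y < t), a (c y) (c t) := by
      have : (2:ℤ) = ∑ y with y = t, a (c y) (c t) := by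
        simp [Finset.sum_filter, H.diag]
      rw [this]
      simp only [Finset.sum_filter]
      rw [← Finset.sum_add_distrib, ← Finset.sum_add_distrib]
      refine Finset.sum_congr rfl fun y _ => ?_
      by_cases h0 : a (c y) (c t) = 0
      · simp [h0]
      by_cases hyt : y = t
      · subst hyt; simp [ht1, ht2]
      rcases H.comp _ _ h0 with h | h
      · have h' := lt_of_le_of_ne h hyt
        simp [h', hyt, h'.not_gt, h.trans ht2]
      · have h' := lt_of_le_of_ne h (Ne.symm hyt)
        simp [h', hyt, h'.not_gt, ht1.trans h]
    rw [hsplit] at hs1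
    have hlowterm : ∀ y, r ≤ y → y < t → a (c y) (c t) ≤ 0 := fun y h1 h2 =>
      H.nonpos (hlow y h1 h2)
    rcases ht1.lt_or_eq with hrt | hrt
    · have hneg : ∑ y with (r ≤ y ∧ y < t), a (c y) (c t) < 0 := by
        obtain ⟨z, hz1, hz2⟩ := exists_le_cov hrt
        refine Finset.sum_neg' ?_ ⟨z, by simp [hz2.lt, hz1], ?_⟩
        · intro s hs; simp at hs; exact hlowterm s hs.1 hs.2
        · rw [H.cov _ _ hz2]; norm_num
      rcases ht2.lt_or_eq with htp | htp
      · have := ih1 t hrt htp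
        omega
      · subst htp
        have h0 : ∑ y with (t < y ∧ y ≤ t), a (c y) (c t) = 0 := by
          apply Finset.sum_eq_zero
          intro y hy; simp at hy; exact absurd hy.2 hy.1.not_ge
        have hA : ∑ y with (r ≤ y ∧ y < t), a (c y) (c t) = -1 := by omega
        obtain ⟨q, hq1, hq2⟩ := exists_le_cov hrt
        -- q is unique adjacent
        have huniq : ∀ y, r ≤ y → y < t → y ≠ q → a (c y) (c t) = 0 := by
          intro y h1 h2 h3
          by_contra h4
          have h5 : a (c y) (c t) = -1 := by
            rcases H.off _ _ (hlow y h1 h2) with h | h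
            · exact absurd h h4
            · exact h
          have hq : q ∈ Finset.univ.filter (fun y => r ≤ y ∧ y < t) := by simp [hq1, hq2.lt]
          have hy : y ∈ (Finset.univ.filter (fun y => r ≤ y ∧ y < t)).erase q := by
            simp [h1, h2, h3]
          rw [← Finset.add_sum_erase _ _ hq, ← Finset.add_sum_erase _ _ hy, H.cov _ _ hq2, h5] at hA
          have : ∑ x ∈ ((Finset.univ.filter (fun y => r ≤ y ∧ y < t)).erase q).erase y,
              a (c x) (c t) ≤ 0 := by
            apply Finset.sum_nonpos
            intro x hx; simp at hx; exact hlowterm x hx.2.2.1 hx.2.2.2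
          omega
        have hall : ∀ y, r ≤ y → y < t → y ≤ q := by
          intro y h1 h2
          obtain ⟨z, hz1, hz2⟩ := exists_le_cov h2
          by_cases hzq : z = q
          · exact hzq ▸ hz1
          · have := huniq z (h1.trans hz1) hz2.lt hzq
            rw [H.cov _ _ hz2] at this; omega
        by_cases hrq : r = q
        · subst hrq
          have : ∑ s with (r < s ∧ s ≤ t), a (c s) (c r) = -1 := by
            rw [Finset.sum_eq_single t]
            · rw [H.symm]; exact H.cov _ _ hq2
            · intro y hy hyt
              simp at hy
              exact absurd (hall y hy.1.le (lt_of_le_of_ne hy.2 hyt)) hy.1.not_ge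
            · intro h; simp [hrp] at h
          omega
        · have hrq' := lt_of_le_of_ne hq1 hrq
          have e := ih _ ?_ r q rfl hrq' ?_
          · have e0 : a (c t) (c r) = 0 := by
              rw [H.symm]; exact huniq r le_rfl hrt hrq
            have : ∑ s with (r < s ∧ s ≤ t), a (c s) (c r)
                = ∑ s with (r < s ∧ s ≤ q), a (c s) (c r) := by
              simp only [Finset.sum_filter]
              refine Finset.sum_congr rfl fun y _ => ?_
              by_cases hyt : y = t
              · subst hyt; simp [e0]
              · by_cases hy : r < y ∧ y ≤ t
                · have := hall y hy.1.le (lt_of_le_of_ne hy.2 hyt)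
                  simp [hy, this]
                · have : ¬ (r < y ∧ y ≤ q) := fun h => hy ⟨h.1, h.2.trans hq2.le⟩
                  simp only [hy, this, if_false]
            omega
          · rw [← hn]
            apply Finset.card_lt_card
            rw [Finset.ssubset_iff_of_subset]
            · refine ⟨t, by simp [hrp.le], by simp [hq2.lt.not_ge]⟩
            · intro x; simp only [Finset.mem_filter, Finset.mem_univ, true_and]
              exact fun h => ⟨h.1, h.2.trans hq2.le⟩
          · intro y h1 h2 h3
            have := huniq y h1 (h2.trans hq2.lt) h2.ne
            rw [h3, H.cov _ _ hq2] at this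
            omega
    · subst hrt
      have h0 : ∑ y with (r ≤ y ∧ y < r), a (c y) (c r) = 0 := by
        apply Finset.sum_eq_zero
        intro y hy; simp at hy; exact absurd hy.1 hy.2.not_ge
      omega

/-- A function with the hook recursions satisfies the reflection recursion. -/
theorem hook_nonneck (H : DHeap c a lam) (h : P → ℤ) (p : P)
    (hlow : ∀ s, s < p → c s ≠ c p)
    (hrec : ∀ r, r < p → h r = 1 - ∑ s with s < r, a (c s) (c r) * h s) :
    (((Finset.univ.filter (fun r => r ≤ p)).card : ℕ) : ℤ)
      = 1 - ∑ s with s < p, a (c s) (c p) * h s := by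
  have hst : ∀ r, r < p → ∑ s with (r < s ∧ s < p), a (c s) (c r) = -1 - a (c p) (c r) := by
    intro r hr
    rw [← H.star _ r p rfl hr (fun s _ h => hlow s h)]
    rw [eq_sub_iff_add_eq]
    have : (Finset.univ.filter (fun s => r < s ∧ s ≤ p))
        = insert p (Finset.univ.filter (fun s => r < s ∧ s < p)) := by
      ext s; simp only [Finset.mem_filter, Finset.mem_univ, true_and, Finset.mem_insert]
      constructor
      · rintro ⟨h1, h2⟩
        rcases h2.lt_or_eq with h2 | h2
        · exact Or.inr ⟨h1, h2⟩
        · exact Or.inl h2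
      · rintro (rfl | ⟨h1, h2⟩)
        · exact ⟨hr, le_rfl⟩
        · exact ⟨h1, h2.le⟩
    rw [this, Finset.sum_insert (by simp)]
    ring
  have hcard : (Finset.univ.filter (fun r => r ≤ p)).card
      = (Finset.univ.filter (fun r => r < p)).card + 1 := by
    have : (Finset.univ.filter (fun s => s ≤ p))
        = insert p (Finset.univ.filter (fun s => s < p)) := by
      ext s; simp [le_iff_lt_or_eq, or_comm]
    rw [this, Finset.card_insert_of_notMem (by simp)]
  rw [hcard]
  have h1 : ((Finset.univ.filter (fun r => r < p)).card : ℤ)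
      = ∑ r with r < p, (h r + ∑ s with s < r, a (c s) (c r) * h s) := by
    rw [Finset.card_eq_sum_ones, Nat.cast_sum]
    refine Finset.sum_congr rfl fun r hr => ?_
    simp at hr
    have := hrec r hr
    push_cast; linarith
  have h2 : ∑ r with r < p, ∑ s with s < r, a (c s) (c r) * h s
      = ∑ s with s < p, ∑ r with (s < r ∧ r < p), a (c r) (c s) * h s := by
    simp only [Finset.sum_filter]
    have : ∀ r, (if r < p then ∑ s, (if s < r then a (c s) (c r) * h s else 0) else 0)
        = ∑ s, (if s < r ∧ r < p then a (c s) (c r) * h s else 0) := by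
      intro r; by_cases h : r < p <;> simp [h]
    simp_rw [this]
    rw [Finset.sum_comm]
    refine Finset.sum_congr rfl fun s _ => ?_
    by_cases h : s < p
    · simp only [h, if_true]
      exact Finset.sum_congr rfl fun r _ => by rw [H.symm]
    · simp only [h, if_false]
      exact Finset.sum_eq_zero fun r _ => by
        rw [if_neg]; exact fun h' => h (h'.1.trans h'.2)
  push_cast
  rw [h1, Finset.sum_add_distrib, h2, ← Finset.sum_add_distrib]
  have h3 : ∀ s ∈ Finset.univ.filter (fun s => s < p),
      h s + ∑ r with (s < r ∧ r < p), a (c r) (c s) * h s = - (a (c s) (c p) * h s) := by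
    intro s hs
    simp at hs
    rw [← Finset.sum_mul, hst s hs, H.symm (c s)]; ring
  rw [Finset.sum_congr rfl h3, Finset.sum_neg_distrib]; ring
end DHeap

namespace DHeap
variable {P D : Type*} [PartialOrder P] [Fintype P] {c : P → D} {a : D → D → ℤ} {lam : D → ℤ}

noncomputable def Ad (G : Finset P) : Finset P :=
  Finset.univ.filter fun t => t ∉ G ∧ ∀ y, t < y → y ∈ G

noncomputable def Rm (c : P → D) (i : D) (G : Finset P) : Finset P :=
  G.filter fun b => c b = i ∧ ∀ y ∈ G, ¬ y < b

def Up (G : Finset P) : Prop := ∀ x ∈ G, ∀ y, x ≤ y → y ∈ G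

theorem mem_Ad {G : Finset P} {t : P} : t ∈ Ad G ↔ t ∉ G ∧ ∀ y, t < y → y ∈ G := by
  simp [Ad]

theorem mem_Rm {G : Finset P} {t : P} {i : D} :
    t ∈ Rm c i G ↔ t ∈ G ∧ c t = i ∧ ∀ y ∈ G, ¬ y < t := by
  simp [Rm]

theorem up_insert {G : Finset P} (hG : Up G) {t : P} (ht : t ∈ Ad G) : Up (insert t G) := by
  intro x hx y hxy
  rw [Finset.mem_insert] at hx ⊢
  rcases hx with rfl | hx
  · rcases hxy.lt_or_eq with h | h
    · exact Or.inr ((mem_Ad.1 ht).2 y h)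
    · exact Or.inl h.symm
  · exact Or.inr (hG x hx y hxy)

theorem up_erase {G : Finset P} (hG : Up G) {b : P} {i : D} (hb : b ∈ Rm c i G) :
    Up (G.erase b) := by
  intro x hx y hxy
  rw [Finset.mem_erase] at hx ⊢
  refine ⟨?_, hG x hx.2 y hxy⟩
  rintro rfl
  exact (mem_Rm.1 hb).2.2 x hx.2 (lt_of_le_of_ne hxy hx.1)

theorem ad_erase {G : Finset P} (hG : Up G) {b : P} {i : D} (hb : b ∈ Rm c i G) :
    b ∈ Ad (G.erase b) := by
  rw [mem_Ad]
  refine ⟨by simp, fun y hy => ?_⟩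
  rw [Finset.mem_erase]
  exact ⟨hy.ne', hG b (mem_Rm.1 hb).1 y hy.le⟩

theorem e_add (H : DHeap c a lam) {G : Finset P} (hG : Up G) {t : P} (ht : t ∈ Ad G) :
    lam (c t) - ∑ q ∈ G, a (c q) (c t) = 1 := by
  rw [mem_Ad] at ht
  rw [H.K t]
  have : ∑ q with t < q, a (c q) (c t) = ∑ q ∈ G, a (c q) (c t) := by
    apply Finset.sum_subset
    · intro q hq; simp at hq; exact ht.2 q hq
    · intro q hq hq'
      simp at hq'
      by_contra h0
      rcases H.comp _ _ h0 with h | h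
      · exact ht.1 (hG q hq t h)
      · rcases h.lt_or_eq with h | h
        · exact hq' h
        · exact ht.1 (h ▸ hq)
  omega

theorem e_rem (H : DHeap c a lam) {G : Finset P} (hG : Up G) {b : P} {i : D}
    (hb : b ∈ Rm c i G) : lam i - ∑ q ∈ G, a (c q) i = -1 := by
  have h1 := H.e_add (up_erase hG hb) (ad_erase hG hb)
  obtain ⟨h2, rfl, _⟩ := mem_Rm.1 hb
  have h3 := H.diag (c b)
  rw [← Finset.add_sum_erase _ _ h2]
  omega

theorem e_ge (H : DHeap c a lam) {G : Finset P} (hG : Up G) (i : D) :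
    -1 ≤ lam i - ∑ q ∈ G, a (c q) i ∧
    (lam i - ∑ q ∈ G, a (c q) i = -1 → ∃ b, b ∈ Rm c i G) := by
  by_cases hex : ∃ b ∈ G, c b = i
  · obtain ⟨b, hb⟩ := (Set.toFinite {t : P | t ∈ G ∧ c t = i}).exists_minimal hex
    obtain ⟨⟨hbG, rfl⟩, hmin⟩ := hb
    have hlow : ∀ y ∈ G, ¬ b ≤ y → a (c y) (c b) ≤ 0 := by
      intro y hy hyb
      apply H.nonpos
      intro hc
      have h0 : a (c y) (c b) ≠ 0 := by rw [hc, H.diag]; norm_num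
      rcases H.comp _ _ h0 with h | h
      · exact hyb (hmin ⟨hy, hc⟩ h)
      · exact hyb h
    have hs : ∑ q ∈ G, a (c q) (c b) = 2 + ∑ q with b < q, a (c q) (c b)
        + ∑ q ∈ G with ¬ b ≤ q, a (c q) (c b) := by
      rw [← Finset.sum_filter_add_sum_filter_not G (fun q => b ≤ q)]
      congr 1
      have : G.filter (fun q => b ≤ q) = insert b (Finset.univ.filter (fun q => b < q)) := by
        ext q; simp only [Finset.mem_filter, Finset.mem_univ, true_and, Finset.mem_insert]
        constructor
        · rintro ⟨_, h⟩
          rcases h.lt_or_eq with h | h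
          · exact Or.inr h
          · exact Or.inl h.symm
        · rintro (rfl | h)
          · exact ⟨hbG, le_rfl⟩
          · exact ⟨hG b hbG q h.le, h.le⟩
      rw [this, Finset.sum_insert (by simp), H.diag]
    have hK := H.K b
    have hnp : ∑ q ∈ G with ¬ b ≤ q, a (c q) (c b) ≤ 0 := by
      apply Finset.sum_nonpos
      intro y hy; simp at hy; exact hlow y hy.1 hy.2
    refine ⟨by omega, fun he => ⟨b, ?_⟩⟩
    rw [mem_Rm]
    refine ⟨hbG, rfl, fun y hy hyb => ?_⟩
    obtain ⟨z, hz1, hz2⟩ := exists_le_cov hyb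
    have : ∑ q ∈ G with ¬ b ≤ q, a (c q) (c b) < 0 := by
      refine Finset.sum_neg' ?_ ⟨z, ?_, ?_⟩
      · intro s hs; simp at hs; exact hlow s hs.1 hs.2
      · simp [hG y hy z hz1, hz2.lt.not_ge]
      · rw [H.cov _ _ hz2]; norm_num
    omega
  · push Not at hex
    have : ∑ q ∈ G, a (c q) i ≤ 0 := Finset.sum_nonpos fun q hq => H.nonpos (hex q hq)
    have := H.nonneg i
    exact ⟨by omega, fun h => by omega⟩

theorem e_le (H : DHeap c a lam) {G : Finset P} (hG : Up G) (p : P) (hp : p ∉ G) :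
    lam (c p) - ∑ q ∈ G, a (c q) (c p) ≤ 1 ∧
    (lam (c p) - ∑ q ∈ G, a (c q) (c p) = 1 → ∃ t ∈ Ad G, c t = c p) := by
  obtain ⟨t, ht⟩ := (Set.toFinite {t : P | t ∉ G ∧ c t = c p}).exists_maximal ⟨p, hp, rfl⟩
  obtain ⟨⟨htG, htc⟩, hmax⟩ := ht
  rw [← htc]
  have hlow : ∀ y, y ∉ G → t < y → a (c y) (c t) ≤ 0 := by
    intro y hy hty
    apply H.nonpos
    intro hc
    exact hty.not_ge (hmax ⟨hy, hc.trans htc⟩ hty.le)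
  have hs : ∑ q with t < q, a (c q) (c t) = ∑ q ∈ G, a (c q) (c t)
      + ∑ q with (q ∉ G ∧ t < q), a (c q) (c t) := by
    rw [← Finset.sum_filter_add_sum_filter_not (Finset.univ.filter (fun q => t < q)) (fun q => q ∈ G)]
    congr 1
    · apply Finset.sum_subset
      · intro q; simp
      · intro q hq hq'
        simp at hq'
        by_contra h0
        rcases H.comp _ _ h0 with h | h
        · exact htG (hG q hq t h)
        · rcases h.lt_or_eq with h | h
          · exact hq' h hq
          · exact htG (h ▸ hq)
    · rw [Finset.filter_filter]
      refine Finset.sum_congr ?_ fun _ _ => rfl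
      ext q; simp [and_comm]
  have hK := H.K t
  have hnp : ∑ q with (q ∉ G ∧ t < q), a (c q) (c t) ≤ 0 := by
    apply Finset.sum_nonpos
    intro y hy; simp at hy; exact hlow y hy.1 hy.2
  refine ⟨by omega, fun he => ⟨t, ?_, rfl⟩⟩
  rw [mem_Ad]
  refine ⟨htG, fun y hy => ?_⟩
  by_contra hyG
  obtain ⟨z, hz1, hz2⟩ := exists_cov_le hy
  have : ∑ q with (q ∉ G ∧ t < q), a (c q) (c t) < 0 := by
    refine Finset.sum_neg' ?_ ⟨z, ?_, ?_⟩
    · intro s hs; simp at hs; exact hlow s hs.1 hs.2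
    · simp only [Finset.mem_filter, Finset.mem_univ, true_and]
      exact ⟨fun h => hyG (hG z h y hz2), hz1.lt⟩
    · rw [H.symm, H.cov _ _ hz1]; norm_num
  omega

def Good : List P → Prop
  | [] => True
  | p :: L => Good L ∧ p ∉ L ∧ ∀ y, p < y → y ∈ L

def rf (a : D → D → ℤ) (i : D) (x : D → ℚ) : D → ℚ := fun j => x j - a i j * x i

noncomputable def f (c : P → D) (a : D → D → ℤ) : List P → Finset P → (D → ℚ) → ℚ
  | [], G, _ => if G = ∅ then 1 else 0
  | p :: L, G, x => f c a L G (rf a (c p) x)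
      + ∑ b ∈ Rm c (c p) G, x (c p) * f c a L (G.erase b) (rf a (c p) x)

theorem good_up : ∀ {L : List P}, Good L → Up L.toFinset
  | [], _ => by intro x hx; simp at hx
  | p :: L, ⟨h1, h2, h3⟩ => by
    rw [List.toFinset_cons]
    refine up_insert (good_up h1) ?_
    rw [mem_Ad]
    exact ⟨by simpa using h2, fun y hy => by simpa using h3 y hy⟩

theorem good_ad {p : P} {L : List P} (h : Good (p :: L)) : p ∈ Ad L.toFinset := by
  obtain ⟨h1, h2, h3⟩ := h
  rw [mem_Ad]
  exact ⟨by simpa using h2, fun y hy => by simpa using h3 y hy⟩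

theorem same (H : DHeap c a lam) {x y : P} (h : c x = c y) : x ≤ y ∨ y ≤ x := by
  apply H.comp
  rw [h, H.diag]; norm_num

theorem supp (H : DHeap c a lam) : ∀ {L : List P}, Good L → ∀ {G : Finset P}, Up G →
    ∀ x, f c a L G x ≠ 0 → G ⊆ L.toFinset
  | [], _, G, _, x, h => by
    simp only [f] at h
    split_ifs at h with h'
    · simp [h']
    · exact absurd rfl h
  | p :: L, hgood, G, hG, x, h => by
    have hgood' := hgood
    obtain ⟨h1, h2, h3⟩ := hgood
    rw [List.toFinset_cons]
    by_cases h0 : f c a L G (rf a (c p) x) = 0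
    · rw [f, h0, zero_add] at h
      obtain ⟨b, hb, hne⟩ := Finset.exists_ne_zero_of_sum_ne_zero h
      have hs := supp H h1 (up_erase hG hb) _ (right_ne_zero_of_mul hne)
      rw [mem_Rm] at hb
      have hbin : b ∈ insert p L.toFinset := by
        rw [Finset.mem_insert]
        by_cases hbp : b = p
        · exact Or.inl hbp
        rcases H.same hb.2.1 with h | h
        · exfalso
          have : p ∈ G.erase b := by
            rw [Finset.mem_erase]; exact ⟨Ne.symm hbp, hG b hb.1 p h⟩
          exact h2 (by simpa using hs this)
        · right
          simpa using h3 b (lt_of_le_of_ne h (Ne.symm hbp))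
      intro y hy
      by_cases hyb : y = b
      · exact hyb ▸ hbin
      · exact Finset.mem_insert_of_mem (hs (by simp [hyb, hy]))
    · exact (supp H h1 hG _ h0).trans (Finset.subset_insert _ _)

theorem rm_uniq (H : DHeap c a lam) {G : Finset P} {i : D} {b b' : P}
    (hb : b ∈ Rm c i G) (hb' : b' ∈ Rm c i G) : b = b' := by
  rw [mem_Rm] at hb hb'
  by_contra hne
  rcases H.same (hb.2.1.trans hb'.2.1.symm) with h | h
  · exact hb'.2.2 b hb.1 (lt_of_le_of_ne h hne)
  · exact hb.2.2 b' hb'.1 (lt_of_le_of_ne h (Ne.symm hne))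

theorem ad_uniq (H : DHeap c a lam) {G : Finset P} {b b' : P}
    (hb : b ∈ Ad G) (hb' : b' ∈ Ad G) (hc : c b = c b') : b = b' := by
  rw [mem_Ad] at hb hb'
  by_contra hne
  rcases H.same hc with h | h
  · exact hb'.1 (hb.2 b' (lt_of_le_of_ne h hne))
  · exact hb.1 (hb'.2 b (lt_of_le_of_ne h (Ne.symm hne)))

theorem rm_insert (H : DHeap c a lam) {G : Finset P} (hG : Up G) {t : P} (ht : t ∈ Ad G)
    {i : D} (hti : c t ≠ i) : Rm c i (insert t G) = (Rm c i G).filter (fun b => ¬ t < b) := by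
  ext b
  simp only [mem_Rm, Finset.mem_filter, Finset.mem_insert]
  constructor
  · rintro ⟨h1, h2, h3⟩
    refine ⟨⟨?_, h2, fun y hy => h3 y (Or.inr hy)⟩, h3 t (Or.inl rfl)⟩
    rcases h1 with rfl | h1
    · exact absurd h2 hti
    · exact h1
  · rintro ⟨⟨h1, h2, h3⟩, h4⟩
    refine ⟨Or.inr h1, h2, ?_⟩
    rintro y (rfl | hy)
    · exact h4
    · exact h3 y hy

theorem rm_insert_self (H : DHeap c a lam) {G : Finset P} (hG : Up G) {t : P} (ht : t ∈ Ad G) :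
    Rm c (c t) (insert t G) = {t} := by
  have : t ∈ Rm c (c t) (insert t G) := by
    rw [mem_Rm]
    refine ⟨by simp, rfl, ?_⟩
    intro y hy hyt
    rw [Finset.mem_insert] at hy
    rcases hy with rfl | hy
    · exact lt_irrefl _ hyt
    · exact (mem_Ad.1 ht).1 (hG y hy t hyt.le)
  ext b
  rw [Finset.mem_singleton]
  exact ⟨fun hb => H.rm_uniq hb this, fun hb => hb ▸ this⟩

theorem chev (H : DHeap c a lam) : ∀ {L : List P}, Good L → ∀ {G : Finset P}, Up G →
    ∀ x : D → ℚ, (∑ q ∈ L.toFinset, x (c q) - ∑ q ∈ G, x (c q)) * f c a L G x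
      = ∑ t ∈ Ad G, f c a L (insert t G) x
  | [], _, G, _, x => by
    have h0 : ∑ t ∈ Ad G, f c a [] (insert t G) x = 0 :=
      Finset.sum_eq_zero fun t _ => by rw [f, if_neg (Finset.insert_ne_empty t G)]
    rw [h0, f]
    split_ifs with h
    · simp [h]
    · simp
  | p :: L, hgood, G, hG, x => by
    have hpad := good_ad hgood
    have hgood' := hgood
    obtain ⟨h1, h2, h3⟩ := hgood
    set i := c p with hi
    set y := rf a i x with hy
    have hyi : y i = - x i := by
      have : y i = x i - a i i * x i := rfl
      rw [this, H.diag]; push_cast; ring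
    have hxy : ∀ j, x j = y j - a j i * y i := by
      intro j; rw [hyi, hy, rf, H.symm j i]; ring
    have hwt : ∀ S : Finset P, ∑ q ∈ S, x (c q) = ∑ q ∈ S, y (c q)
        - ((∑ q ∈ S, a (c q) i : ℤ) : ℚ) * y i := by
      intro S
      rw [Finset.sum_congr rfl (fun q _ => hxy (c q)), Finset.sum_sub_distrib, ← Finset.sum_mul]
      push_cast; rfl
    have hL := H.e_add (good_up h1) hpad
    rw [List.toFinset_cons, Finset.sum_insert (mem_Ad.1 hpad).1, hwt, hwt]
    obtain ⟨e, he⟩ : ∃ e, e = lam i - ∑ q ∈ G, a (c q) i := ⟨_, rfl⟩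
    have hG' : ∑ q ∈ G, a (c q) i = lam i - e := by omega
    have hL' : ∑ q ∈ L.toFinset, a (c q) i = lam i - 1 := by rw [hi]; omega
    rw [hG', hL']
    have IH := chev H h1 hG y
    set W := ∑ q ∈ L.toFinset, y (c q) with hW
    set V := ∑ q ∈ G, y (c q) with hV
    have hlin : (x i + (W - ((lam i - 1 : ℤ) : ℚ) * y i) - (V - ((lam i - e : ℤ) : ℚ) * y i))
        = W - V - e * y i := by
      rw [show x i = - y i by rw [hyi]; ring]; push_cast; ring
    rw [hlin]
    have hge := H.e_ge hG i
    by_cases hr : ∃ b, b ∈ Rm c i G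
    · obtain ⟨b, hb⟩ := hr
      have he1 : e = -1 := by rw [he]; exact H.e_rem hG hb
      have hRm : Rm c i G = {b} := by
        ext b'; rw [Finset.mem_singleton]
        exact ⟨fun h => H.rm_uniq h hb, fun h => h ▸ hb⟩
      have hnoad : ∀ t ∈ Ad G, c t ≠ i := by
        intro t ht hc
        have := H.e_add hG ht
        rw [hc] at this; omega
      have IH' := chev H h1 (up_erase hG hb) y
      rw [← hW] at IH'
      have hV' : ∑ q ∈ G.erase b, y (c q) = V - y i := by
        rw [hV, ← Finset.add_sum_erase _ _ (mem_Rm.1 hb).1, (mem_Rm.1 hb).2.1]; ring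
      have hAd : Ad (G.erase b) = insert b ((Ad G).filter (fun t => ¬ t < b)) := by
        ext t
        simp only [mem_Ad, Finset.mem_insert, Finset.mem_filter, Finset.mem_erase]
        constructor
        · rintro ⟨k1, k2⟩
          by_cases htb : t = b
          · exact Or.inl htb
          · right
            exact ⟨⟨fun h => k1 ⟨htb, h⟩, fun z hz => (k2 z hz).2⟩, fun h => (k2 b h).1 rfl⟩
        · rintro (rfl | ⟨⟨k1, k2⟩, k3⟩)
          · exact ⟨fun h => h.1 rfl, fun z hz => ⟨hz.ne', hG t (mem_Rm.1 hb).1 z hz.le⟩⟩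
          · exact ⟨fun h => k1 h.2, fun z hz => ⟨fun h => k3 (h ▸ hz), k2 z hz⟩⟩
      rw [hAd, Finset.sum_insert (by
        simp only [Finset.mem_filter, mem_Ad]
        exact fun h => h.1.1 (mem_Rm.1 hb).1), Finset.insert_erase (mem_Rm.1 hb).1, hV'] at IH'
      have hterm : ∀ t ∈ Ad G, f c a (p :: L) (insert t G) x = f c a L (insert t G) y
          + if ¬ t < b then x i * f c a L (insert t (G.erase b)) y else 0 := by
        intro t ht
        rw [f, ← hi, ← hy, H.rm_insert hG ht (hnoad t ht), hRm, Finset.sum_filter,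
          Finset.sum_singleton]
        congr 2
        have hbt : b ≠ t := by rintro rfl; exact (mem_Ad.1 ht).1 (mem_Rm.1 hb).1
        rw [Finset.erase_insert_of_ne hbt.symm]
      rw [Finset.sum_congr rfl hterm, Finset.sum_add_distrib, ← IH, ← Finset.sum_filter,
        ← Finset.mul_sum, f, ← hi, ← hy, hRm, Finset.sum_singleton]
      rw [show ∑ t ∈ Ad G with ¬ t < b, f c a L (insert t (G.erase b)) y
        = (W - (V - y i)) * f c a L (G.erase b) y - f c a L G y by rw [IH']; ring]
      rw [he1, hyi]; push_cast; ring
    · have hRm : Rm c i G = ∅ := by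
        rw [Finset.eq_empty_iff_forall_notMem]; exact fun b hb => hr ⟨b, hb⟩
      have hterm : ∀ t ∈ Ad G, f c a (p :: L) (insert t G) x = f c a L (insert t G) y
          + if c t = i then x i * f c a L G y else 0 := by
        intro t ht
        rw [f, ← hi, ← hy]
        congr 1
        split_ifs with hc
        · rw [← hc, H.rm_insert_self hG ht, Finset.sum_singleton,
            Finset.erase_insert (mem_Ad.1 ht).1]
        · rw [H.rm_insert hG ht hc, hRm]; simp
      rw [Finset.sum_congr rfl hterm, Finset.sum_add_distrib, ← IH, f, ← hi, ← hy, hRm,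
        Finset.sum_empty, add_zero]
      by_cases h0 : f c a L G y = 0
      · simp [h0]
      have hpG : p ∉ G := fun h => (mem_Ad.1 hpad).1 (supp H h1 hG y h0 h)
      have hle := H.e_le hG p hpG
      rw [← hi, ← he] at hle
      rw [← he] at hge
      have hne : e ≠ -1 := fun h => hr (hge.2 h)
      rcases (by omega : e = 0 ∨ e = 1) with e0 | e1
      · rw [Finset.sum_eq_zero]
        · rw [e0]; push_cast; ring
        · intro t ht
          rw [if_neg]
          intro hc
          have := H.e_add hG ht
          rw [hc] at this; omega
      · obtain ⟨t, ht, htc⟩ := hle.2 e1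
        rw [Finset.sum_eq_single t]
        · rw [if_pos htc, e1, hyi]; push_cast; ring
        · intro t' ht' hne'
          rw [if_neg]
          intro hc
          exact hne' (H.ad_uniq ht' ht (hc.trans htc.symm))
        · exact fun h => absurd ht h

theorem f_empty : ∀ (L : List P) (x : D → ℚ), f c a L ∅ x = 1
  | [], x => by simp [f]
  | p :: L, x => by
    rw [f, f_empty L]; simp [Rm]

theorem f_full (H : DHeap c a lam) (h : P → ℤ)
    (hrec : ∀ r, h r = 1 - ∑ s with s < r, a (c s) (c r) * h s) :
    ∀ {L : List P}, Good L → ∀ x : D → ℚ,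
    (∀ k, x k = 1 - ∑ s with s ∉ L, (a (c s) k : ℚ) * h s) →
    f c a L L.toFinset x = ∏ q ∈ L.toFinset, (h q : ℚ)
  | [], _, x, _ => by simp [f]
  | p :: L, hgood, x, hx => by
    have hpad := good_ad hgood
    have hgood' := hgood
    obtain ⟨h1, h2, h3⟩ := hgood
    have hxp : x (c p) = h p := by
      rw [hx, hrec p]
      push_cast
      congr 1
      symm
      apply Finset.sum_subset
      · intro s hs
        simp only [Finset.mem_filter, Finset.mem_univ, true_and, List.mem_cons, not_or] at hs ⊢
        refine ⟨hs.ne, fun hsL => h2 ?_⟩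
        have := good_up h1 s (by simpa using hsL) p hs.le
        simpa using this
      · intro s hs hs'
        simp only [Finset.mem_filter, Finset.mem_univ, true_and, List.mem_cons, not_or] at hs hs'
        have : a (c s) (c p) = 0 := by
          by_contra h0
          rcases H.comp _ _ h0 with h | h
          · exact hs' (lt_of_le_of_ne h hs.1)
          · exact hs.2 (h3 s (lt_of_le_of_ne h (Ne.symm hs.1)))
        rw [this]; simp
    rw [f]
    have hz : f c a L (p :: L).toFinset (rf a (c p) x) = 0 := by
      by_contra h0
      have := supp H h1 (good_up hgood') _ h0
      exact (mem_Ad.1 hpad).1 (this (by simp))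
    rw [hz, zero_add, List.toFinset_cons, H.rm_insert_self (good_up h1) hpad,
      Finset.sum_singleton, Finset.erase_insert (mem_Ad.1 hpad).1,
      Finset.prod_insert (mem_Ad.1 hpad).1, hxp]
    congr 1
    apply f_full H h hrec h1
    intro k
    rw [rf, hxp, hx k]
    have : (Finset.univ.filter (fun s => s ∉ L))
        = insert p (Finset.univ.filter (fun s => s ∉ p :: L)) := by
      ext s
      simp only [Finset.mem_filter, Finset.mem_univ, true_and, List.mem_cons, not_or,
        Finset.mem_insert]
      constructor
      · intro h
        by_cases hs : s = p
        · exact Or.inl hs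
        · exact Or.inr ⟨hs, h⟩
      · rintro (rfl | h)
        · exact h2
        · exact h.2
    rw [this, Finset.sum_insert (by simp)]
    ring
end DHeap

namespace DHeap
variable {P D : Type*} [PartialOrder P] [Fintype P] {c : P → D} {a : D → D → ℤ} {lam : D → ℤ}

noncomputable def LE : ℕ → Finset (List P)
  | 0 => {[]}
  | k + 1 => (LE k).biUnion fun l => (Ad l.toFinset).image (fun t => t :: l)

theorem mem_LE : ∀ (k : ℕ) (l : List P), l ∈ LE k ↔ Good l ∧ l.length = k
  | 0, l => by
    simp only [LE, Finset.mem_singleton, List.length_eq_zero_iff]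
    constructor
    · rintro rfl; exact ⟨trivial, rfl⟩
    · exact fun h => h.2
  | k + 1, l => by
    simp only [LE, Finset.mem_biUnion, Finset.mem_image, mem_LE k]
    constructor
    · rintro ⟨l', ⟨h1, h2⟩, t, ht, rfl⟩
      rw [mem_Ad] at ht
      refine ⟨⟨h1, by simpa using ht.1, fun y hy => by simpa using ht.2 y hy⟩, by simp [h2]⟩
    · rintro ⟨h1, h2⟩
      cases l with
      | nil => simp at h2
      | cons t l =>
        exact ⟨l, ⟨h1.1, by simpa using h2⟩, t, good_ad h1, rfl⟩

theorem sum_LE (g : Finset P → ℚ) (k : ℕ) :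
    ∑ l ∈ LE (P := P) (k + 1), g l.toFinset
      = ∑ l ∈ LE (P := P) k, ∑ t ∈ Ad l.toFinset, g (insert t l.toFinset) := by
  rw [LE, Finset.sum_biUnion]
  · refine Finset.sum_congr rfl fun l _ => ?_
    rw [Finset.sum_image]
    · simp
    · intro t _ t' _ h; simpa using h
  · intro l _ l' _ hne
    rw [Function.onFun, Finset.disjoint_left]
    intro m hm hm'
    simp only [Finset.mem_image] at hm hm'
    obtain ⟨t, _, rfl⟩ := hm
    obtain ⟨t', _, h⟩ := hm'
    simp at h
    exact hne h.2.symm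

theorem good_nodup : ∀ {l : List P}, Good l → l.Nodup
  | [], _ => List.nodup_nil
  | _ :: _, h => List.nodup_cons.2 ⟨h.2.1, good_nodup h.1⟩

theorem exists_good : ∀ k ≤ Fintype.card P, ∃ l : List P, Good l ∧ l.length = k
  | 0, _ => ⟨[], trivial, rfl⟩
  | k + 1, hk => by
    obtain ⟨l, h1, h2⟩ := exists_good k (by omega)
    have : ∃ p, p ∉ l := by
      by_contra hcon
      push Not at hcon
      have h3 := List.toFinset_card_of_nodup (good_nodup h1)
      have h4 : l.toFinset = Finset.univ := by ext p; simp [hcon p]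
      rw [h4, Finset.card_univ] at h3
      omega
    obtain ⟨p, hp⟩ := (Set.toFinite {p : P | p ∉ l}).exists_maximal this
    refine ⟨p :: l, ⟨h1, hp.1, fun y hy => ?_⟩, by simp [h2]⟩
    by_contra hyl
    exact hy.not_ge (hp.2 hyl hy.le)

theorem count_LE (H : DHeap c a lam) (h : P → ℤ)
    (hrec : ∀ r, h r = 1 - ∑ s with s < r, a (c s) (c r) * h s) :
    ((LE (P := P) (Fintype.card P)).card : ℚ) * ∏ q : P, (h q : ℚ)
      = (Fintype.card P).factorial := by
  obtain ⟨L, hL, hlen⟩ := exists_good (P := P) _ le_rfl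
  have hfull : ∀ l : List P, Good l → l.length = Fintype.card P → l.toFinset = Finset.univ := by
    intro l h1 h2
    apply Finset.eq_univ_of_card
    rw [List.toFinset_card_of_nodup (good_nodup h1), h2]
  have hLu := hfull L hL hlen
  have hstep : ∀ k ≤ Fintype.card P, ∑ l ∈ LE (P := P) k, f c a L l.toFinset (fun _ => 1)
      = ((Fintype.card P).descFactorial k : ℚ) := by
    intro k
    induction k with
    | zero => intro _; simp [LE, f_empty]
    | succ k ih =>
      intro hk
      rw [sum_LE (fun G => f c a L G (fun _ => 1))]
      have : ∀ l ∈ LE (P := P) k, ∑ t ∈ Ad l.toFinset, f c a L (insert t l.toFinset) (fun _ => 1)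
          = ((Fintype.card P : ℚ) - k) * f c a L l.toFinset (fun _ => 1) := by
        intro l hl
        rw [mem_LE] at hl
        rw [← H.chev hL (good_up hl.1)]
        rw [hLu]
        simp [List.toFinset_card_of_nodup (good_nodup hl.1), hl.2]
      rw [Finset.sum_congr rfl this, ← Finset.mul_sum, ih (by omega), Nat.descFactorial_succ]
      rw [Nat.cast_mul, Nat.cast_sub (by omega)]
  have h1 := hstep _ le_rfl
  rw [Nat.descFactorial_self] at h1
  rw [← h1]
  have h2 : ∀ l ∈ LE (P := P) (Fintype.card P), f c a L l.toFinset (fun _ => 1)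
      = ∏ q : P, (h q : ℚ) := by
    intro l hl
    rw [mem_LE] at hl
    rw [hfull l hl.1 hl.2, ← hLu]
    apply H.f_full h hrec hL
    intro k
    have : ∀ s, s ∈ L := fun s => by
      have : s ∈ L.toFinset := by rw [hLu]; simp
      simpa using this
    simp [this]
  rw [Finset.sum_congr rfl h2]; simp

theorem good_iff : ∀ (l : List P), l.Nodup → (∀ x, x ∈ l) →
    ∀ (m k : List P), l = m ++ k → (Good k ↔ ∀ (i j : ℕ) (hi : i < l.length) (hj : j < l.length),
      m.length ≤ i → l[i] < l[j] → i < j) := by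
  intro l hnd hall m k
  induction k generalizing m with
  | nil =>
    intro h
    simp only [List.append_nil] at h
    subst h
    simp only [Good, true_iff]
    intro i j hi hj h; omega
  | cons p k ih =>
    intro h
    have h' : l = (m ++ [p]) ++ k := by simpa using h
    have ih' := ih (m ++ [p]) h'
    have hm : m.length < l.length := by rw [h]; simp
    have hlm : l[m.length] = p := by simp [h]
    simp only [Good]
    rw [ih']
    constructor
    · rintro ⟨h1, h2, h3⟩ i j hi hj hmi hlt
      rcases hmi.lt_or_eq with hmi | hmi
      · exact h1 i j hi hj (by simpa using hmi) hlt
      · subst hmi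
        rw [hlm] at hlt
        have := h3 _ hlt
        obtain ⟨n, hn, he⟩ := List.getElem_of_mem this
        have hn' : m.length + 1 + n < l.length := by rw [h']; simp; omega
        have : l[m.length + 1 + n] = l[j] := by
          rw [← he]; simp only [h']
          rw [List.getElem_append_right (by simp)]; simp
        have := (List.Nodup.getElem_inj_iff hnd).1 this
        omega
    · intro hA
      refine ⟨fun i j hi hj hmi => hA i j hi hj (by simp at hmi; omega), ?_, ?_⟩
      · rw [h] at hnd
        have := (List.nodup_append.1 hnd).2.1
        exact (List.nodup_cons.1 this).1
      · intro y hy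
        obtain ⟨n, hn, he⟩ := List.getElem_of_mem (hall y)
        have := hA m.length n hm hn le_rfl (by rw [hlm, he]; exact hy)
        rw [← he]
        simp only [h']
        rw [List.getElem_append_right (by simp; omega)]
        exact List.getElem_mem _

theorem card_linExt :
    (Finset.univ.filter (fun e : Fin (Fintype.card P) ≃ P => ∀ i j, e i < e j → j < i)).card
      = (LE (P := P) (Fintype.card P)).card := by
  have key : ∀ e : Fin (Fintype.card P) ≃ P, (Good (List.ofFn (fun i => e i.rev))) ↔
      ∀ i j, e i < e j → j < i := by
    intro e
    have hnd : (List.ofFn (fun i => e i.rev)).Nodup :=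
      List.nodup_ofFn.2 (e.injective.comp Fin.rev_injective)
    rw [good_iff (List.ofFn (fun i => e i.rev)) hnd (fun x => by
      rw [List.mem_ofFn]; exact ⟨(e.symm x).rev, by simp⟩) []
        (List.ofFn (fun i => e i.rev)) (List.nil_append _).symm]
    constructor
    · intro h i j hij
      have := h i.rev j.rev (by rw [List.length_ofFn]; exact i.rev.2)
        (by rw [List.length_ofFn]; exact j.rev.2) (Nat.zero_le _)
        (by simpa only [List.getElem_ofFn, Fin.eta, Fin.rev_rev] using hij)
      exact Fin.rev_lt_rev.1 this
    · intro h i j hi hj _ hij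
      simp only [List.length_ofFn] at hi hj
      simp only [List.getElem_ofFn] at hij
      have := h _ _ hij
      exact Fin.rev_lt_rev.1 this
  apply Finset.card_bij (fun e _ => List.ofFn (fun i => e i.rev))
  · intro e he
    rw [mem_LE]
    simp only [Finset.mem_filter, Finset.mem_univ, true_and] at he
    exact ⟨(key e).2 he, by simp⟩
  · intro e _ e' _ h
    have := List.ofFn_injective h
    ext i
    have := congrFun this i.rev
    simpa using this
  · intro l hl
    rw [mem_LE] at hl
    have hinj : Function.Injective (fun i : Fin (Fintype.card P) =>
        l[(i.rev : ℕ)]'(by rw [hl.2]; exact i.rev.2)) := by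
      intro i j hij
      have := (List.Nodup.getElem_inj_iff (good_nodup hl.1)).1 hij
      exact Fin.rev_injective (Fin.ext this)
    let e : Fin (Fintype.card P) ≃ P := Equiv.ofBijective _
      ((Fintype.bijective_iff_injective_and_card _).2 ⟨hinj, by simp⟩)
    have he : List.ofFn (fun i => e i.rev) = l := by
      apply List.ext_getElem
      · simp [hl.2]
      · intro n h1 h2
        simp only [e, List.getElem_ofFn, Equiv.ofBijective_apply, Fin.rev_rev]
    refine ⟨e, ?_, he⟩
    simp only [Finset.mem_filter, Finset.mem_univ, true_and]
    rw [← key, he]; exact hl.1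
end DHeap

namespace DC
variable {P : Type*} [PartialOrder P] [Fintype P]

inductive DI : ℕ → P → P → P → P → Prop
  | base {r q w z : P} : r ⋖ w → r ⋖ z → w ⋖ q → z ⋖ q → w ≠ z →
      Set.Icc r q = {r, w, z, q} → DI 3 r q w z
  | step {k : ℕ} {r q u v w z : P} : DI k u v w z → r ⋖ u → v ⋖ q →
      Set.Icc r q = insert r (insert q (Set.Icc u v)) → DI (k + 1) r q w z

theorem cov_incomp {p x y : P} (hx : p ⋖ x) (hy : p ⋖ y) (hne : x ≠ y) : ¬ x ≤ y := fun h =>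
  hy.2 hx.lt (lt_of_le_of_ne h hne)

theorem cov_incomp' {p x y : P} (hx : x ⋖ p) (hy : y ⋖ p) (hne : x ≠ y) : ¬ x ≤ y := fun h =>
  hx.2 (lt_of_le_of_ne h hne) hy.lt

theorem DI.facts {k : ℕ} {r q w z : P} (h : DI k r q w z) :
    3 ≤ k ∧ r < w ∧ r < z ∧ w < q ∧ z < q ∧ ¬ w ≤ z ∧ ¬ z ≤ w := by
  induction h with
  | base h1 h2 h3 h4 h5 h6 =>
    exact ⟨le_rfl, h1.lt, h2.lt, h3.lt, h4.lt, cov_incomp h1 h2 h5, cov_incomp h2 h1 h5.symm⟩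
  | step h h1 h2 h3 ih =>
    obtain ⟨i1, i2, i3, i4, i5, i6, i7⟩ := ih
    exact ⟨by omega, h1.lt.trans i2, h1.lt.trans i3, i4.trans h2.lt, i5.trans h2.lt, i6, i7⟩

theorem DI.of_k : ∀ (k : ℕ) {r q w z : P}, IsDkIntervalWith k r q w z → DI k r q w z := by
  intro k
  induction k with
  | zero => intro r q w z h; exact absurd h.2.1.1 (by omega)
  | succ k ih =>
    intro r q w z h
    obtain ⟨hrq, ⟨hk, hw, hz, hwz, hzw, hcase, hT, hN, hTc⟩, hNc⟩ := h
    have hrT : r ∈ {x ∈ Set.Icc r q | x ≤ w ∧ x ≤ z} := ⟨⟨le_rfl, hrq⟩, hw.1, hz.1⟩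
    have hqN : q ∈ {x ∈ Set.Icc r q | w ≤ x ∧ z ≤ x} := ⟨⟨hrq, le_rfl⟩, hw.2, hz.2⟩
    have hrw : r < w := lt_of_le_of_ne hw.1 (by rintro rfl; exact hwz hz.1)
    have hrz : r < z := lt_of_le_of_ne hz.1 (by rintro rfl; exact hzw hw.1)
    have hwq : w < q := lt_of_le_of_ne hw.2 (by rintro rfl; exact hzw hz.2)
    have hzq : z < q := lt_of_le_of_ne hz.2 (by rintro rfl; exact hwz hw.2)
    by_cases hk2 : k = 2
    · subst hk2
      obtain ⟨t, ht⟩ := Set.ncard_eq_one.1 hTc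
      obtain ⟨n, hn⟩ := Set.ncard_eq_one.1 hNc
      have : r = t := by rw [ht] at hrT; exact hrT
      subst this
      have : q = n := by rw [hn] at hqN; exact hqN
      subst this
      have hT' : ∀ x, r ≤ x → x ≤ w → x ≤ z → x = r := by
        intro x h1 h2 h3
        have : x ∈ {x ∈ Set.Icc r q | x ≤ w ∧ x ≤ z} := ⟨⟨h1, h2.trans hw.2⟩, h2, h3⟩
        rw [ht] at this; exact this
      have hN' : ∀ x, x ≤ q → w ≤ x → z ≤ x → x = q := by
        intro x h1 h2 h3
        have : x ∈ {x ∈ Set.Icc r q | w ≤ x ∧ z ≤ x} := ⟨⟨hw.1.trans h2, h1⟩, h2, h3⟩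
        rw [hn] at this; exact this
      have hall : ∀ x, r ≤ x → x ≤ q → x = r ∨ x = w ∨ x = z ∨ x = q := by
        intro x h1 h2
        rcases hcase x ⟨h1, h2⟩ with h | h | h | h
        · exact Or.inr (Or.inl h)
        · exact Or.inr (Or.inr (Or.inl h))
        · exact Or.inl (hT' x h1 h.1 h.2)
        · exact Or.inr (Or.inr (Or.inr (hN' x h2 h.1 h.2)))
      refine DI.base ⟨hrw, fun x h1 h2 => ?_⟩ ⟨hrz, fun x h1 h2 => ?_⟩ ⟨hwq, fun x h1 h2 => ?_⟩
        ⟨hzq, fun x h1 h2 => ?_⟩ (by rintro rfl; exact hwz le_rfl) ?_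
      · rcases hall x h1.le (h2.le.trans hw.2) with rfl | rfl | rfl | rfl
        · exact lt_irrefl _ h1
        · exact lt_irrefl _ h2
        · exact hzw h2.le
        · exact absurd hw.2 h2.not_ge
      · rcases hall x h1.le (h2.le.trans hz.2) with rfl | rfl | rfl | rfl
        · exact lt_irrefl _ h1
        · exact hwz h2.le
        · exact lt_irrefl _ h2
        · exact absurd hz.2 h2.not_ge
      · rcases hall x (hw.1.trans h1.le) h2.le with rfl | rfl | rfl | rfl
        · exact absurd hw.1 h1.not_ge
        · exact lt_irrefl _ h1
        · exact hwz h1.le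
        · exact lt_irrefl _ h2
      · rcases hall x (hz.1.trans h1.le) h2.le with rfl | rfl | rfl | rfl
        · exact absurd hz.1 h1.not_ge
        · exact hzw h1.le
        · exact lt_irrefl _ h1
        · exact lt_irrefl _ h2
      · ext x
        simp only [Set.mem_Icc, Set.mem_insert_iff, Set.mem_singleton_iff]
        constructor
        · exact fun h => hall x h.1 h.2
        · rintro (rfl | rfl | rfl | rfl)
          · exact ⟨le_rfl, hrq⟩
          · exact hw
          · exact hz
          · exact ⟨hrq, le_rfl⟩
    · have hTf := Set.toFinite {x ∈ Set.Icc r q | x ≤ w ∧ x ≤ z}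
      have hNf := Set.toFinite {x ∈ Set.Icc r q | w ≤ x ∧ z ≤ x}
      have c1 := Set.ncard_sdiff_singleton_of_mem hrT
      have c2 := Set.ncard_sdiff_singleton_of_mem hqN
      have n1 : ({x ∈ Set.Icc r q | x ≤ w ∧ x ≤ z} \ {r}).Nonempty := by
        rw [← Set.ncard_pos (Set.toFinite _)]; omega
      have n2 : ({x ∈ Set.Icc r q | w ≤ x ∧ z ≤ x} \ {q}).Nonempty := by
        rw [← Set.ncard_pos (Set.toFinite _)]; omega
      obtain ⟨u, hu, humin⟩ := (Set.toFinite _).exists_minimal n1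
      obtain ⟨v, hv, hvmax⟩ := (Set.toFinite _).exists_maximal n2
      have hu' : ∀ x, r < x → x ≤ w → x ≤ z → u ≤ x := by
        intro x h1 h2 h3
        have hx : x ∈ {x ∈ Set.Icc r q | x ≤ w ∧ x ≤ z} := ⟨⟨h1.le, h2.trans hw.2⟩, h2, h3⟩
        by_cases hxu : x = u
        · exact hxu.ge
        rcases hT hx hu.1 hxu with h | h
        · exact humin ⟨hx, h1.ne'⟩ h
        · exact h
      have hv' : ∀ x, x < q → w ≤ x → z ≤ x → x ≤ v := by
        intro x h1 h2 h3
        have hx : x ∈ {x ∈ Set.Icc r q | w ≤ x ∧ z ≤ x} := ⟨⟨hw.1.trans h2, h1.le⟩, h2, h3⟩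
        by_cases hxu : x = v
        · exact hxu.le
        rcases hN hx hv.1 hxu with h | h
        · exact h
        · exact hvmax ⟨hx, h1.ne⟩ h
      obtain ⟨⟨⟨hru, huq⟩, huw, huz⟩, hur⟩ := hu
      obtain ⟨⟨⟨hrv, hvq⟩, hwv, hzv⟩, hvq'⟩ := hv
      have hru' : r < u := lt_of_le_of_ne hru (Ne.symm hur)
      have hvq'' : v < q := lt_of_le_of_ne hvq hvq'
      have huv := huw.trans hwv
      have hIcc : Set.Icc r q = insert r (insert q (Set.Icc u v)) := by
        ext x
        simp only [Set.mem_Icc, Set.mem_insert_iff]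
        constructor
        · rintro ⟨h1, h2⟩
          by_cases hxr : x = r
          · exact Or.inl hxr
          by_cases hxq : x = q
          · exact Or.inr (Or.inl hxq)
          right; right
          rcases hcase x ⟨h1, h2⟩ with rfl | rfl | h | h
          · exact ⟨huw, hwv⟩
          · exact ⟨huz, hzv⟩
          · exact ⟨hu' x (lt_of_le_of_ne h1 (Ne.symm hxr)) h.1 h.2, h.1.trans hwv⟩
          · exact ⟨huw.trans h.1, hv' x (lt_of_le_of_ne h2 hxq) h.1 h.2⟩
        · rintro (rfl | rfl | h)
          · exact ⟨le_rfl, hrq⟩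
          · exact ⟨hrq, le_rfl⟩
          · exact ⟨hru.trans h.1, h.2.trans hvq⟩
      have sT : {x ∈ Set.Icc u v | x ≤ w ∧ x ≤ z} = {x ∈ Set.Icc r q | x ≤ w ∧ x ≤ z} \ {r} := by
        ext x
        simp only [Set.mem_Icc, Set.mem_ofPred_eq, Set.mem_sdiff, Set.mem_singleton_iff]
        constructor
        · rintro ⟨⟨h1, h2⟩, h3, h4⟩
          exact ⟨⟨⟨hru.trans h1, h2.trans hvq⟩, h3, h4⟩, (hru'.trans_le h1).ne'⟩
        · rintro ⟨⟨⟨h1, h2⟩, h3, h4⟩, h5⟩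
          exact ⟨⟨hu' x (lt_of_le_of_ne h1 (Ne.symm h5)) h3 h4, h3.trans hwv⟩, h3, h4⟩
      have sN : {x ∈ Set.Icc u v | w ≤ x ∧ z ≤ x} = {x ∈ Set.Icc r q | w ≤ x ∧ z ≤ x} \ {q} := by
        ext x
        simp only [Set.mem_Icc, Set.mem_ofPred_eq, Set.mem_sdiff, Set.mem_singleton_iff]
        constructor
        · rintro ⟨⟨h1, h2⟩, h3, h4⟩
          exact ⟨⟨⟨hru.trans h1, h2.trans hvq⟩, h3, h4⟩, (h2.trans_lt hvq'').ne⟩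
        · rintro ⟨⟨⟨h1, h2⟩, h3, h4⟩, h5⟩
          exact ⟨⟨huw.trans h3, hv' x (lt_of_le_of_ne h2 h5) h3 h4⟩, h3, h4⟩
      refine DI.step (ih ⟨huv, ⟨by omega, ⟨huw, hwv⟩, ⟨huz, hzv⟩, hwz, hzw, ?_, ?_, ?_, ?_⟩, ?_⟩)
        ⟨hru', fun x h1 h2 => ?_⟩ ⟨hvq'', fun x h1 h2 => ?_⟩ hIcc
      · exact fun x hx => hcase x ⟨hru.trans hx.1, hx.2.trans hvq⟩
      · rw [sT]; exact hT.mono Set.sdiff_subset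
      · rw [sN]; exact hN.mono Set.sdiff_subset
      · rw [sT]; omega
      · rw [sN]; omega
      · exact h2.not_ge (hu' x h1 (h2.le.trans huw) (h2.le.trans huz))
      · exact h1.not_ge (hv' x h2 (hwv.trans h1.le) (hzv.trans h1.le))

theorem DI.to_k {k : ℕ} {r q w z : P} (h : DI k r q w z) : IsDkIntervalWith k r q w z := by
  have hf := h.facts
  induction h with
  | @base r q w z h1 h2 h3 h4 h5 h6 =>
    obtain ⟨i1, i2, i3, i4, i5, i6, i7⟩ := hf
    have sT : {x ∈ Set.Icc r q | x ≤ w ∧ x ≤ z} = {r} := by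
      rw [h6]
      ext x
      simp only [Set.mem_ofPred_eq, Set.mem_insert_iff, Set.mem_singleton_iff]
      constructor
      · rintro ⟨rfl | rfl | rfl | rfl, j1, j2⟩
        · rfl
        · exact absurd j2 i6
        · exact absurd j1 i7
        · exact absurd j1 i4.not_ge
      · rintro rfl; exact ⟨Or.inl rfl, i2.le, i3.le⟩
    have sN : {x ∈ Set.Icc r q | w ≤ x ∧ z ≤ x} = {q} := by
      rw [h6]
      ext x
      simp only [Set.mem_ofPred_eq, Set.mem_insert_iff, Set.mem_singleton_iff]
      constructor
      · rintro ⟨rfl | rfl | rfl | rfl, j1, j2⟩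
        · exact absurd j1 i2.not_ge
        · exact absurd j2 i7
        · exact absurd j1 i6
        · rfl
      · rintro rfl; exact ⟨Or.inr (Or.inr (Or.inr rfl)), i4.le, i5.le⟩
    refine ⟨(i2.trans i4).le, ⟨i1, ⟨i2.le, i4.le⟩, ⟨i3.le, i5.le⟩, i6, i7, ?_, ?_, ?_, ?_⟩, ?_⟩
    · rw [h6]
      intro x hx
      simp only [Set.mem_insert_iff, Set.mem_singleton_iff] at hx
      rcases hx with rfl | rfl | rfl | rfl
      · exact Or.inr (Or.inr (Or.inl ⟨i2.le, i3.le⟩))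
      · exact Or.inl rfl
      · exact Or.inr (Or.inl rfl)
      · exact Or.inr (Or.inr (Or.inr ⟨i4.le, i5.le⟩))
    · rw [sT]; exact IsChain.singleton
    · rw [sN]; exact IsChain.singleton
    · rw [sT]; simp
    · rw [sN]; simp
  | @step k r q u v w z h h1 h2 h3 ih =>
    have hf' := h.facts
    obtain ⟨j0, ⟨j1, j2, j3, j4, j5, j6, j7, j8, j9⟩, j10⟩ := ih hf'
    obtain ⟨i1, i2, i3, i4, i5, i6, i7⟩ := hf
    have sT : {x ∈ Set.Icc r q | x ≤ w ∧ x ≤ z} = insert r {x ∈ Set.Icc u v | x ≤ w ∧ x ≤ z} := by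
      rw [h3]
      ext x
      simp only [Set.mem_ofPred_eq, Set.mem_insert_iff]
      constructor
      · rintro ⟨rfl | rfl | hx, k1, k2⟩
        · exact Or.inl rfl
        · exact absurd k1 i4.not_ge
        · exact Or.inr ⟨hx, k1, k2⟩
      · rintro (rfl | ⟨hx, k1, k2⟩)
        · exact ⟨Or.inl rfl, i2.le, i3.le⟩
        · exact ⟨Or.inr (Or.inr hx), k1, k2⟩
    have sN : {x ∈ Set.Icc r q | w ≤ x ∧ z ≤ x} = insert q {x ∈ Set.Icc u v | w ≤ x ∧ z ≤ x} := by
      rw [h3]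
      ext x
      simp only [Set.mem_ofPred_eq, Set.mem_insert_iff]
      constructor
      · rintro ⟨rfl | rfl | hx, k1, k2⟩
        · exact absurd k1 i2.not_ge
        · exact Or.inl rfl
        · exact Or.inr ⟨hx, k1, k2⟩
      · rintro (rfl | ⟨hx, k1, k2⟩)
        · exact ⟨Or.inr (Or.inl rfl), i4.le, i5.le⟩
        · exact ⟨Or.inr (Or.inr hx), k1, k2⟩
    refine ⟨(i2.trans i4).le, ⟨i1, ⟨i2.le, i4.le⟩, ⟨i3.le, i5.le⟩, i6, i7, ?_, ?_, ?_, ?_⟩, ?_⟩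
    · rw [h3]
      intro x hx
      simp only [Set.mem_insert_iff] at hx
      rcases hx with rfl | rfl | hx
      · exact Or.inr (Or.inr (Or.inl ⟨i2.le, i3.le⟩))
      · exact Or.inr (Or.inr (Or.inr ⟨i4.le, i5.le⟩))
      · exact j6 x hx
    · rw [sT]
      exact j7.insert fun b hb _ => Or.inl (h1.le.trans hb.1.1)
    · rw [sN]
      exact j8.insert fun b hb _ => Or.inr (hb.1.2.trans h2.le)
    · rw [sT, Set.ncard_insert_of_notMem (fun hr => h1.lt.not_ge hr.1.1) (Set.toFinite _), j9]
      omega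
    · rw [sN, Set.ncard_insert_of_notMem (fun hr => h2.lt.not_ge hr.1.2) (Set.toFinite _), j10]
      omega

theorem iff_DI {r q : P} : IsDInterval r q ↔ ∃ k w z, DI k r q w z := by
  constructor
  · rintro ⟨k, w, z, h⟩; exact ⟨k, w, z, DI.of_k k h⟩
  · rintro ⟨k, w, z, h⟩; exact ⟨k, w, z, h.to_k⟩

theorem minus {r q : P} (h : IsDInterval r q) :
    ∃ k, IsDkMinusConvex k (Set.Icc r q \ {q}) := by
  obtain ⟨k, w, z, h⟩ := iff_DI.1 h
  obtain ⟨i1, i2, i3, i4, i5, i6, i7⟩ := h.facts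
  obtain ⟨j0, ⟨j1, j2, j3, j4, j5, j6, j7, j8, j9⟩, j10⟩ := h.to_k
  have hqN : q ∈ {x ∈ Set.Icc r q | w ≤ x ∧ z ≤ x} := ⟨⟨j0, le_rfl⟩, i4.le, i5.le⟩
  refine ⟨k, ?_, w, z, ⟨i1, ⟨j2, i4.ne⟩, ⟨j3, i5.ne⟩, i6, i7, fun x hx => j6 x hx.1, ?_, ?_, ?_⟩, ?_⟩
  · rintro a ⟨ha, haq⟩ b ⟨hb, hbq⟩ x h1 h2
    refine ⟨⟨ha.1.trans h1, h2.trans hb.2⟩, ?_⟩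
    rintro rfl
    exact hbq (le_antisymm hb.2 h2)
  · refine j7.mono ?_
    rintro x ⟨hx, hx'⟩
    exact ⟨hx.1, hx'⟩
  · refine j8.mono ?_
    rintro x ⟨hx, hx'⟩
    exact ⟨hx.1, hx'⟩
  · rw [← j9]; congr 1
    ext x
    simp only [Set.mem_ofPred_eq, Set.mem_sdiff, Set.mem_singleton_iff]
    constructor
    · exact fun hx => ⟨hx.1.1, hx.2⟩
    · refine fun hx => ⟨⟨hx.1, ?_⟩, hx.2⟩
      rintro rfl
      exact i4.not_ge hx.2.1
  · have := Set.ncard_sdiff_singleton_of_mem hqN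
    have e : {x ∈ Set.Icc r q \ {q} | w ≤ x ∧ z ≤ x} = {x ∈ Set.Icc r q | w ≤ x ∧ z ≤ x} \ {q} := by
      ext x
      simp only [Set.mem_ofPred_eq, Set.mem_sdiff, Set.mem_singleton_iff]
      tauto
    rw [e, this, j10]; omega

theorem minus3 {p x y : P} (hx : p ⋖ x) (hy : p ⋖ y) (hne : x ≠ y) :
    IsDkMinusConvex 3 ({p, x, y} : Set P) := by
  have h1 := cov_incomp hx hy hne
  have h2 := cov_incomp hy hx hne.symm
  have sT : {t ∈ ({p, x, y} : Set P) | t ≤ x ∧ t ≤ y} = {p} := by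
    ext t
    simp only [Set.mem_ofPred_eq, Set.mem_insert_iff, Set.mem_singleton_iff]
    constructor
    · rintro ⟨rfl | rfl | rfl, h3, h4⟩
      · rfl
      · exact absurd h4 h1
      · exact absurd h3 h2
    · rintro rfl; exact ⟨Or.inl rfl, hx.le, hy.le⟩
  have sN : {t ∈ ({p, x, y} : Set P) | x ≤ t ∧ y ≤ t} = ∅ := by
    ext t
    simp only [Set.mem_ofPred_eq, Set.mem_insert_iff, Set.mem_singleton_iff, Set.mem_empty_iff_false,
      iff_false]
    rintro ⟨rfl | rfl | rfl, h3, h4⟩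
    · exact hx.lt.not_ge h3
    · exact h2 h4
    · exact h1 h3
  refine ⟨?_, x, y, ⟨le_rfl, by simp, by simp, h1, h2, ?_, ?_, ?_, ?_⟩, ?_⟩
  · have key : ∀ t s, p ⋖ s → p ≤ t → t ≤ s → t = p ∨ t = s := by
      intro t s hs h3 h4
      rcases h3.lt_or_eq with h | h
      · right; by_contra hne; exact hs.2 h (lt_of_le_of_ne h4 hne)
      · exact Or.inl h.symm
    intro a ha b hb t h3 h4
    simp only [Set.mem_insert_iff, Set.mem_singleton_iff] at ha hb ⊢
    have hpt : p ≤ t := by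
      rcases ha with rfl | rfl | rfl
      · exact h3
      · exact hx.le.trans h3
      · exact hy.le.trans h3
    rcases hb with rfl | rfl | rfl
    · exact Or.inl (le_antisymm h4 hpt)
    · rcases key t b hx hpt h4 with h | h
      · exact Or.inl h
      · exact Or.inr (Or.inl h)
    · rcases key t b hy hpt h4 with h | h
      · exact Or.inl h
      · exact Or.inr (Or.inr h)
  · intro t ht
    simp only [Set.mem_insert_iff, Set.mem_singleton_iff] at ht
    rcases ht with rfl | rfl | rfl
    · exact Or.inr (Or.inr (Or.inl ⟨hx.le, hy.le⟩))
    · exact Or.inl rfl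
    · exact Or.inr (Or.inl rfl)
  · rw [sT]; exact IsChain.singleton
  · rw [sN]; exact IsChain.empty
  · rw [sT]; simp
  · rw [sN]; simp
end DC

namespace DC
variable {P : Type*} [PartialOrder P] [Fintype P]

def BaseD (r q w z : P) : Prop := w ≠ z ∧ r ⋖ w ∧ r ⋖ z ∧ w ⋖ q ∧ z ⋖ q ∧
  Set.Icc r q = {r, w, z, q} ∧ ∀ x, x ⋖ q → x = w ∨ x = z

def StepD (r q u v : P) : Prop := IsDInterval u v ∧ r ⋖ u ∧ v ⋖ q ∧
  Set.Icc r q = insert r (insert q (Set.Icc u v)) ∧ ∀ x, x ⋖ q → x = v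

theorem R_lt {r q : P} (h : IsDInterval r q) : r < q := by
  obtain ⟨k, w, z, h⟩ := iff_DI.1 h
  obtain ⟨i1, i2, i3, i4, i5, i6, i7⟩ := h.facts
  exact i2.trans i4

theorem DI_base (hP : IsDComplete P) {r q w z : P} (h1 : r ⋖ w) (h2 : r ⋖ z) (h3 : w ⋖ q)
    (h4 : z ⋖ q) (h5 : w ≠ z) (h6 : Set.Icc r q = {r, w, z, q}) : BaseD r q w z := by
  refine ⟨h5, h1, h2, h3, h4, h6, fun x hx => ?_⟩
  have hR : IsDInterval r q := iff_DI.2 ⟨3, w, z, DI.base h1 h2 h3 h4 h5 h6⟩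
  have := hP.2.1 r q hR x hx
  rw [h6] at this
  simp only [Set.mem_insert_iff, Set.mem_singleton_iff] at this
  rcases this with rfl | h | h | rfl
  · exact absurd h3.lt (hx.2 h1.lt)
  · exact Or.inl h
  · exact Or.inr h
  · exact absurd hx.lt (lt_irrefl _)

theorem DI_step (hP : IsDComplete P) {k : ℕ} {r q u v w z : P} (h : DI k u v w z) (h1 : r ⋖ u)
    (h2 : v ⋖ q) (h3 : Set.Icc r q = insert r (insert q (Set.Icc u v))) : StepD r q u v := by
  have huv : IsDInterval u v := iff_DI.2 ⟨k, w, z, h⟩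
  refine ⟨huv, h1, h2, h3, fun x hx => ?_⟩
  have hR : IsDInterval r q := iff_DI.2 ⟨k + 1, w, z, DI.step h h1 h2 h3⟩
  have := hP.2.1 r q hR x hx
  rw [h3] at this
  simp only [Set.mem_insert_iff, Set.mem_Icc] at this
  rcases this with rfl | rfl | h
  · exact absurd ((R_lt huv).trans h2.lt) (hx.2 h1.lt)
  · exact absurd hx.lt (lt_irrefl _)
  · by_contra hne
    exact hx.2 (lt_of_le_of_ne h.2 hne) h2.lt

theorem R_induct (hP : IsDComplete P) {motive : P → P → Prop}
    (base : ∀ r q w z, BaseD r q w z → motive r q)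
    (step : ∀ r q u v, StepD r q u v → motive u v → motive r q)
    {r q : P} (h : IsDInterval r q) : motive r q := by
  obtain ⟨k, w, z, h⟩ := iff_DI.1 h
  induction h with
  | base h1 h2 h3 h4 h5 h6 => exact base _ _ _ _ (DI_base hP h1 h2 h3 h4 h5 h6)
  | step hd h1 h2 h3 ih => exact step _ _ _ _ (DI_step hP hd h1 h2 h3) (ih (iff_DI.2 ⟨_, _, _, hd⟩))

theorem R_cases (hP : IsDComplete P) {r q : P} (h : IsDInterval r q) :
    (∃ w z, BaseD r q w z) ∨ ∃ u v, StepD r q u v := by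
  refine R_induct hP (motive := fun r q => (∃ w z, BaseD r q w z) ∨ ∃ u v, StepD r q u v) ?_ ?_ h
  · exact fun r q w z h => Or.inl ⟨w, z, h⟩
  · exact fun r q u v h _ => Or.inr ⟨u, v, h⟩

theorem L1 (hP : IsDComplete P) {p x y : P} (hx : p ⋖ x) (hy : p ⋖ y) (hne : x ≠ y) :
    ∃ q, IsDInterval p q ∧ BaseD p q x y := by
  obtain ⟨q, hq, a, ⟨w, z, h⟩, hS⟩ := hP.1 3 _ (minus3 hx hy hne)
  have h := DI.of_k _ h
  have hp : p ∈ Set.Icc a q := by rw [hS]; simp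
  have hx' : x ∈ Set.Icc a q := by rw [hS]; simp
  have hy' : y ∈ Set.Icc a q := by rw [hS]; simp
  have ha : a ∈ Set.Icc a q := ⟨le_rfl, hp.1.trans hp.2⟩
  rw [hS] at ha
  have hap : a = p := by
    simp only [Set.mem_insert_iff, Set.mem_singleton_iff] at ha hq
    rcases ha with rfl | h | rfl | rfl
    · exact absurd (Or.inl (le_antisymm hp.1 hp.2)) hq
    · exact h
    · exact absurd hp.1 hx.lt.not_ge
    · exact absurd hp.1 hy.lt.not_ge
  subst hap
  have hf := h.facts
  cases h with
  | base h1 h2 h3 h4 h5 h6 =>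
    have hB := DI_base hP h1 h2 h3 h4 h5 h6
    have hR : IsDInterval a q := iff_DI.2 ⟨3, w, z, DI.base h1 h2 h3 h4 h5 h6⟩
    rw [h6] at hx' hy'
    simp only [Set.mem_insert_iff, Set.mem_singleton_iff] at hx' hy' hq
    have hxwz : x = w ∨ x = z := by
      rcases hx' with rfl | h | h | rfl
      · exact absurd hx.lt (lt_irrefl _)
      · exact Or.inl h
      · exact Or.inr h
      · simp at hq
    have hywz : y = w ∨ y = z := by
      rcases hy' with rfl | h | h | rfl
      · exact absurd hy.lt (lt_irrefl _)
      · exact Or.inl h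
      · exact Or.inr h
      · simp at hq
    refine ⟨q, hR, ?_⟩
    rcases hxwz with rfl | rfl <;> rcases hywz with rfl | rfl
    · exact absurd rfl hne
    · exact hB
    · obtain ⟨k1, k2, k3, k4, k5, k6, k7⟩ := hB
      refine ⟨k1.symm, k3, k2, k5, k4, ?_, fun t ht => (k7 t ht).symm⟩
      rw [k6]; ext t; simp only [Set.mem_insert_iff, Set.mem_singleton_iff]; tauto
    · exact absurd rfl hne
  | step h _ _ _ => have := h.facts.1; omega

theorem L1' (hP : IsDComplete P) {p u v : P} (hpu : p ⋖ u) (huniq : ∀ x, p ⋖ x → x = u)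
    (h : IsDInterval u v) : ∃ q, IsDInterval p q ∧ StepD p q u v := by
  obtain ⟨k, w, z, h⟩ := iff_DI.1 h
  obtain ⟨i1, i2, i3, i4, i5, i6, i7⟩ := h.facts
  obtain ⟨j0, ⟨j1, j2, j3, j4, j5, j6, j7, j8, j9⟩, j10⟩ := h.to_k
  have hup : ∀ t, p < t → u ≤ t := by
    intro t ht
    obtain ⟨s, hs1, hs2⟩ := exists_covBy_le_of_lt ht
    rw [← huniq s hs1]; exact hs2
  have hpw := hpu.lt.trans i2
  have hpz := hpu.lt.trans i3
  have hM : IsDkMinusConvex (k + 1) (insert p (Set.Icc u v)) := by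
    have sT : {x ∈ insert p (Set.Icc u v) | x ≤ w ∧ x ≤ z}
        = insert p {x ∈ Set.Icc u v | x ≤ w ∧ x ≤ z} := by
      ext x
      simp only [Set.mem_ofPred_eq, Set.mem_insert_iff]
      constructor
      · rintro ⟨h1 | h1, h2⟩
        · exact Or.inl h1
        · exact Or.inr ⟨h1, h2⟩
      · rintro (rfl | h1)
        · exact ⟨Or.inl rfl, hpw.le, hpz.le⟩
        · exact ⟨Or.inr h1.1, h1.2⟩
    have sN : {x ∈ insert p (Set.Icc u v) | w ≤ x ∧ z ≤ x}
        = {x ∈ Set.Icc u v | w ≤ x ∧ z ≤ x} := by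
      ext x
      simp only [Set.mem_ofPred_eq, Set.mem_insert_iff]
      constructor
      · rintro ⟨rfl | h1, h2⟩
        · exact absurd h2.1 hpw.not_ge
        · exact ⟨h1, h2⟩
      · exact fun h1 => ⟨Or.inr h1.1, h1.2⟩
    refine ⟨?_, w, z, ⟨by omega, Or.inr j2, Or.inr j3, i6, i7, ?_, ?_, ?_, ?_⟩, ?_⟩
    · intro a ha b hb t h1 h2
      rw [Set.mem_insert_iff] at ha hb ⊢
      have hpt : p ≤ t := by
        rcases ha with rfl | ha
        · exact h1
        · exact hpu.le.trans (ha.1.trans h1)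
      rcases hpt.lt_or_eq with hpt | hpt
      · right
        rcases hb with rfl | hb
        · exact absurd h2 hpt.not_ge
        · exact ⟨hup t hpt, h2.trans hb.2⟩
      · exact Or.inl hpt.symm
    · rintro x (rfl | hx)
      · exact Or.inr (Or.inr (Or.inl ⟨hpw.le, hpz.le⟩))
      · exact j6 x hx
    · rw [sT]
      exact j7.insert fun b hb _ => Or.inl (hpu.le.trans hb.1.1)
    · rw [sN]; exact j8
    · rw [sT, Set.ncard_insert_of_notMem (fun hr => hpu.lt.not_ge hr.1.1) (Set.toFinite _), j9]
      omega
    · rw [sN, j10]; omega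
  obtain ⟨q, hq, a, ⟨w', z', h'⟩, hS⟩ := hP.1 _ _ hM
  have h' := DI.of_k _ h'
  rw [Set.mem_insert_iff, not_or] at hq
  have hp : p ∈ Set.Icc a q := by rw [hS]; simp
  have hv' : v ∈ Set.Icc a q := by rw [hS]; exact Or.inr (Or.inr ⟨j0, le_rfl⟩)
  have ha : a ∈ Set.Icc a q := ⟨le_rfl, hp.1.trans hp.2⟩
  rw [hS] at ha
  have hap : a = p := by
    rcases ha with rfl | h | h
    · exact absurd (le_antisymm hp.1 hp.2) hq.1
    · exact h
    · exact absurd (h.1.trans hp.1) hpu.lt.not_ge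
  subst hap
  refine ⟨q, iff_DI.2 ⟨_, _, _, h'⟩, ?_⟩
  generalize hkk : k + 1 = kk at h'
  cases h' with
  | base => omega
  | @step k2 _ _ u' v2 _ _ hd h1 h2 h3 =>
    have hu' := huniq _ h1
    subst hu'
    have hv2 : v2 = v := by
      apply le_antisymm
      · have hh : v2 ∈ Set.Icc a q := ⟨(h1.lt.trans (R_lt (iff_DI.2 ⟨_, _, _, hd⟩))).le, h2.le⟩
        rw [hS] at hh
        rcases hh with rfl | rfl | hh
        · exact absurd h2.lt (lt_irrefl _)
        · exact absurd (h1.lt.trans (R_lt (iff_DI.2 ⟨_, _, _, hd⟩))) (lt_irrefl _)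
        · exact hh.2
      · rw [h3] at hv'
        rcases hv' with rfl | rfl | hh
        · exact absurd j0 hpu.lt.not_ge
        · exact absurd ⟨j0, le_rfl⟩ hq.2
        · exact hh.2
    subst hv2
    exact DI_step hP hd h1 h2 h3

theorem L2_aux (hP : IsDComplete P) : ∀ (x1 x2 x3 p12 p13 p23 : P), x1 ≠ x2 → x1 ≠ x3 → x2 ≠ x3 →
    p12 ⋖ x1 → p12 ⋖ x2 → p13 ⋖ x1 → p13 ⋖ x3 → p23 ⋖ x2 → p23 ⋖ x3 → False := by
  intro x1
  induction x1 using WellFoundedGT.induction with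
  | ind x1 ih =>
    intro x2 x3 p12 p13 p23 n12 n13 n23 a1 a2 b1 b3 c2 c3
    obtain ⟨y12, -, e1, e2, e3, e4, e5, e6, e7⟩ := L1 hP a1 a2 n12
    obtain ⟨y13, -, f1, f2, f3, f4, f5, f6, f7⟩ := L1 hP b1 b3 n13
    obtain ⟨y23, -, g1, g2, g3, g4, g5, g6, g7⟩ := L1 hP c2 c3 n23
    refine ih y12 e4.lt y13 y23 x1 x2 x3 ?_ ?_ ?_ e4 f4 e5 g4 f5 g5
    · rintro rfl
      rcases e7 x3 f5 with h | h
      · exact n13 h.symm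
      · exact n23 h.symm
    · rintro rfl
      rcases e7 x3 g5 with h | h
      · exact n13 h.symm
      · exact n23 h.symm
    · rintro rfl
      rcases f7 x2 g4 with h | h
      · exact n12 h.symm
      · exact n23 h

theorem L2 (hP : IsDComplete P) {p x y t : P} (hx : p ⋖ x) (hy : p ⋖ y) (hne : x ≠ y)
    (ht : p ⋖ t) : t = x ∨ t = y := by
  by_contra hcon
  push Not at hcon
  exact L2_aux hP x y t p p p hne hcon.1.symm hcon.2.symm hx hy hx ht hy ht

theorem left_unique (hP : IsDComplete P) {p p' q : P} (h : IsDInterval p q)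
    (h' : IsDInterval p' q) : p = p' := by
  revert p'
  have key : ∀ {p p' q : P}, IsDInterval p q → IsDInterval p' q →
      (Set.Icc p q \ {q}) \ {p} = (Set.Icc p' q \ {q}) \ {p'} → p = p' := by
    intro p p' q h h' he
    obtain ⟨k, hk⟩ := minus h
    obtain ⟨k', hk'⟩ := minus h'
    have hp : p ∈ Set.Icc p q \ {q} := ⟨⟨le_rfl, (R_lt h).le⟩, (R_lt h).ne⟩
    have hp' : p' ∈ Set.Icc p' q \ {q} := ⟨⟨le_rfl, (R_lt h').le⟩, (R_lt h').ne⟩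
    have := hP.2.2 k k' _ _ hk hk' p hp p' hp' (fun x hx => hx.1.1) (fun x hx => hx.1.1) he
    apply le_antisymm
    · rw [← this] at hp'; exact hp'.1.1
    · rw [this] at hp; exact hp.1.1
  have sB : ∀ {p q w z : P}, BaseD p q w z → (Set.Icc p q \ {q}) \ {p} = {w, z} := by
    rintro p q w z ⟨k1, k2, k3, k4, k5, k6, k7⟩
    rw [k6]; ext t
    simp only [Set.mem_insert_iff, Set.mem_singleton_iff, Set.mem_sdiff]
    constructor
    · tauto
    · rintro (rfl | rfl)
      · exact ⟨⟨Or.inr (Or.inl rfl), k4.lt.ne⟩, k2.lt.ne'⟩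
      · exact ⟨⟨Or.inr (Or.inr (Or.inl rfl)), k5.lt.ne⟩, k3.lt.ne'⟩
  have sS : ∀ {p q u v : P}, StepD p q u v → (Set.Icc p q \ {q}) \ {p} = Set.Icc u v := by
    rintro p q u v ⟨k1, k2, k3, k4, k5⟩
    rw [k4]; ext t
    simp only [Set.mem_insert_iff, Set.mem_singleton_iff, Set.mem_sdiff]
    constructor
    · tauto
    · intro ht
      exact ⟨⟨Or.inr (Or.inr ht), (ht.2.trans_lt k3.lt).ne⟩, (k2.lt.trans_le ht.1).ne'⟩
  refine R_induct hP (motive := fun p q => IsDInterval p q → ∀ p', IsDInterval p' q → p = p')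
    ?_ ?_ h h
  · intro p q w z hB hR p' h'
    rcases R_cases hP h' with ⟨w', z', hB'⟩ | ⟨u', v', hS'⟩
    · apply key hR h'
      rw [sB hB, sB hB']
      obtain ⟨k1, k2, k3, k4, k5, k6, k7⟩ := hB
      obtain ⟨l1, l2, l3, l4, l5, l6, l7⟩ := hB'
      ext t
      simp only [Set.mem_insert_iff, Set.mem_singleton_iff]
      constructor
      · rintro (rfl | rfl)
        · exact l7 _ k4
        · exact l7 _ k5
      · rintro (rfl | rfl)
        · exact k7 _ l4
        · exact k7 _ l5
    · exact absurd ((hS'.2.2.2.2 _ hB.2.2.2.1).trans (hS'.2.2.2.2 _ hB.2.2.2.2.1).symm) hB.1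
  · intro p q u v hS ih hR p' h'
    rcases R_cases hP h' with ⟨w', z', hB'⟩ | ⟨u', v', hS'⟩
    · exact absurd ((hS.2.2.2.2 _ hB'.2.2.2.1).trans (hS.2.2.2.2 _ hB'.2.2.2.2.1).symm) hB'.1
    · apply key hR h'
      rw [sS hS, sS hS']
      have hv := hS.2.2.2.2 _ hS'.2.2.1
      subst hv
      rw [ih hS.1 _ hS'.1]

theorem L3' (hP : IsDComplete P) {u v : P} (h : IsDInterval u v) :
    ∀ {p x}, p ⋖ u → p ⋖ x → x ≠ u → x ≤ v := by
  refine R_induct hP (motive := fun u v => ∀ {p x}, p ⋖ u → p ⋖ x → x ≠ u → x ≤ v) ?_ ?_ h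
  · rintro u v w z ⟨k1, k2, k3, k4, k5, k6, k7⟩ p x hu hx hne
    obtain ⟨t, -, l1, l2, l3, l4, l5, l6, l7⟩ := L1 hP hu hx hne.symm
    rcases L2 hP k2 k3 k1 l4 with rfl | rfl
    · exact l5.le.trans k4.le
    · exact l5.le.trans k5.le
  · rintro u v u2 v2 ⟨k1, k2, k3, k4, k5⟩ ih p x hu hx hne
    obtain ⟨t, -, l1, l2, l3, l4, l5, l6, l7⟩ := L1 hP hu hx hne.symm
    by_cases ht : t = u2
    · subst ht
      exact l5.le.trans ((R_lt k1).le.trans k3.le)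
    · exact l5.le.trans ((ih k2 l4 ht).trans k3.le)

theorem step_unique (hP : IsDComplete P) {r q u v : P} (h : StepD r q u v) :
    ∀ x, r ⋖ x → x = u := by
  obtain ⟨k1, k2, k3, k4, k5⟩ := h
  intro x hx
  by_contra hne
  have h1 := L3' hP k1 k2 hx hne
  have : x ∈ Set.Icc r q := ⟨hx.le, h1.trans k3.le⟩
  rw [k4] at this
  rcases this with rfl | rfl | h
  · exact lt_irrefl _ hx.lt
  · exact k3.lt.not_ge h1
  · exact cov_incomp k2 hx (Ne.symm hne) h.1

def Cfg (u v q q' : P) : Prop := IsDInterval u v ∧ v ⋖ q ∧ v ⋖ q' ∧ q ≠ q' ∧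
  (∀ x, x ⋖ q → x = v) ∧ (∀ x, x ⋖ q' → x = v)

theorem lemG (hP : IsDComplete P) {u v : P} (h : IsDInterval u v) :
    ∀ b, IsDInterval v b → (∀ x, x ≤ b → x ≤ v ∨ v ≤ x) →
      ∃ u' v' q q', Cfg u' v' q q' ∧ b ≤ v' := by
  refine R_induct hP (motive := fun u v => ∀ b, IsDInterval v b → (∀ x, x ≤ b → x ≤ v ∨ v ≤ x) →
      ∃ u' v' q q', Cfg u' v' q q' ∧ b ≤ v') ?_ ?_ h
  · rintro u v w z ⟨k1, k2, k3, k4, k5, k6, k7⟩ b hb hcomp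
    have huniq : ∀ w, w ⋖ v → ∀ x, w ⋖ x → x = v := by
      intro w hw x hx
      by_contra hne
      rcases hcomp x (L3' hP hb hw hx hne) with h | h
      · exact cov_incomp hx hw hne h
      · exact cov_incomp hw hx (Ne.symm hne) h
    obtain ⟨w', hw', l1, l2, l3, l4, l5⟩ := L1' hP k4 (huniq w k4) hb
    obtain ⟨z', hz', m1, m2, m3, m4, m5⟩ := L1' hP k5 (huniq z k5) hb
    refine ⟨v, b, w', z', ⟨hb, l3, m3, ?_, l5, m5⟩, le_rfl⟩
    rintro rfl
    exact k1 (left_unique hP hw' hz')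
  · rintro u v u2 v2 ⟨k1, k2, k3, k4, k5⟩ ih b hb hcomp
    have huniq : ∀ w, w ⋖ v → ∀ x, w ⋖ x → x = v := by
      intro w hw x hx
      by_contra hne
      rcases hcomp x (L3' hP hb hw hx hne) with h | h
      · exact cov_incomp hx hw hne h
      · exact cov_incomp hw hx (Ne.symm hne) h
    obtain ⟨b2, hb2, l1, l2, l3, l4, l5⟩ := L1' hP k3 (huniq v2 k3) hb
    obtain ⟨u', v', q, q', hC, hle⟩ := ih b2 hb2 (by
      intro x hx
      rcases hx.lt_or_eq with hx | rfl
      · obtain ⟨s, hs1, hs2⟩ := exists_le_covBy_of_lt hx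
        rw [l5 s hs2] at hs1
        rcases hcomp x hs1 with h | h
        · rcases h.lt_or_eq with h | rfl
          · obtain ⟨s, hs1, hs2⟩ := exists_le_covBy_of_lt h
            rw [k5 s hs2] at hs1
            exact Or.inl hs1
          · exact Or.inr k3.le
        · exact Or.inr (k3.le.trans h)
      · exact Or.inr (R_lt hb2).le)
    exact ⟨u', v', q, q', hC, l3.le.trans hle⟩

theorem no_Cfg (hP : IsDComplete P) : ∀ (v u q q' : P), ¬ Cfg u v q q' := by
  intro v
  induction v using WellFoundedGT.induction with
  | ind v ih =>
    rintro u q q' ⟨h1, h2, h3, h4, h5, h6⟩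
    obtain ⟨b, hb, l1, l2, l3, l4, l5, l6, l7⟩ := L1 hP h2 h3 h4
    obtain ⟨u', v', r, r', hC, hle⟩ := lemG hP h1 b hb (by
      intro x hx
      have aux : ∀ q, v ⋖ q → (∀ x, x ⋖ q → x = v) → ∀ x, x ≤ q → x ≤ v ∨ v ≤ x := by
        intro q hq hu x hx
        rcases hx.lt_or_eq with hx | rfl
        · obtain ⟨s, hs1, hs2⟩ := exists_le_covBy_of_lt hx
          rw [hu s hs2] at hs1
          exact Or.inl hs1
        · exact Or.inr hq.le
      rcases hx.lt_or_eq with hx | rfl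
      · obtain ⟨s, hs1, hs2⟩ := exists_le_covBy_of_lt hx
        rcases l7 s hs2 with rfl | rfl
        · exact aux _ h2 h5 x hs1
        · exact aux _ h3 h6 x hs1
      · exact Or.inr (R_lt hb).le)
    exact ih v' ((R_lt hb).trans_le hle) u' r r' hC

theorem right_unique (hP : IsDComplete P) {p q q' : P} (h : IsDInterval p q)
    (h' : IsDInterval p q') : q = q' := by
  revert q'
  refine R_induct hP (motive := fun p q => ∀ {q'}, IsDInterval p q' → q = q') ?_ ?_ h
  · intro p q w z hB q' h'
    rcases R_cases hP h' with ⟨w', z', hB'⟩ | ⟨u', v', hS'⟩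
    · obtain ⟨k1, k2, k3, k4, k5, k6, k7⟩ := hB
      obtain ⟨l1, l2, l3, l4, l5, l6, l7⟩ := hB'
      by_contra hne
      have hw : w ⋖ q' := by
        rcases L2 hP l2 l3 l1 k2 with rfl | rfl
        · exact l4
        · exact l5
      have hz : z ⋖ q' := by
        rcases L2 hP l2 l3 l1 k3 with rfl | rfl
        · exact l4
        · exact l5
      have aux : ∀ w, w ⋖ q → w ⋖ q' → ({w, q, q'} : Set P) \ {w} = {q, q'} := by
        intro w h1 h2
        ext t
        simp only [Set.mem_insert_iff, Set.mem_singleton_iff, Set.mem_sdiff]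
        constructor
        · tauto
        · rintro (rfl | rfl)
          · exact ⟨Or.inr (Or.inl rfl), h1.lt.ne'⟩
          · exact ⟨Or.inr (Or.inr rfl), h2.lt.ne'⟩
      have aux2 : ∀ w, w ⋖ q → w ⋖ q' → ∀ x ∈ ({w, q, q'} : Set P), w ≤ x := by
        intro w h1 h2 x hx
        simp only [Set.mem_insert_iff, Set.mem_singleton_iff] at hx
        rcases hx with rfl | rfl | rfl
        · exact le_rfl
        · exact h1.le
        · exact h2.le
      have := hP.2.2 3 3 _ _ (minus3 k4 hw hne) (minus3 k5 hz hne) w (by simp) z (by simp)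
        (aux2 w k4 hw) (aux2 z k5 hz) ((aux w k4 hw).trans (aux z k5 hz).symm)
      have hm : w ∈ ({w, q, q'} : Set P) := by simp
      rw [this] at hm
      simp only [Set.mem_insert_iff, Set.mem_singleton_iff] at hm
      rcases hm with h | h | h
      · exact k1 h
      · exact k4.lt.ne h
      · exact hw.lt.ne h
    · have := step_unique hP hS'
      exact absurd ((this _ hB.2.1).trans (this _ hB.2.2.1).symm) hB.1
  · intro p q u v hS ih q' h'
    rcases R_cases hP h' with ⟨w', z', hB'⟩ | ⟨u', v', hS'⟩
    · have := step_unique hP hS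
      exact absurd ((this _ hB'.2.1).trans (this _ hB'.2.2.1).symm) hB'.1
    · have := step_unique hP hS' _ hS.2.1
      subst this
      have := ih hS'.1
      subst this
      by_contra hne
      exact no_Cfg hP v u q q' ⟨hS.1, hS.2.2.1, hS'.2.2.1, hne, hS.2.2.2.2, hS'.2.2.2.2⟩
end DC

namespace DC
variable {P : Type*} [PartialOrder P] [Fintype P]

def col (x : P) : Quotient (diagSetoid P) := Quotient.mk (diagSetoid P) x

theorem col_R {x y : P} (h : IsDInterval x y) : col x = col y :=
  Quotient.sound (s := diagSetoid P) (Relation.EqvGen.rel _ _ h)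

theorem same_comp (hP : IsDComplete P) {x y : P} (h : col x = col y) :
    Relation.ReflTransGen IsDInterval x y ∨ Relation.ReflTransGen IsDInterval y x := by
  have hru : Relator.RightUnique (IsDInterval (P := P)) := fun a b c h1 h2 => right_unique hP h1 h2
  have hlu : Relator.RightUnique (Function.swap (IsDInterval (P := P))) :=
    fun a b c h1 h2 => left_unique hP h1 h2
  have hE : Relation.EqvGen (fun x y => IsDInterval x y) x y := Quotient.exact (s := diagSetoid P) h
  clear h
  induction hE with
  | rel x y hxy => exact Or.inl (Relation.ReflTransGen.single hxy)
  | refl x => exact Or.inl .refl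
  | symm x y _ ih => exact ih.symm
  | trans x y z hxy hyz ih1 ih2 =>
    rcases ih1 with i1 | i1 <;> rcases ih2 with i2 | i2
    · exact Or.inl (i1.trans i2)
    · have j1 := Relation.reflTransGen_swap.2 i1
      have j2 := Relation.reflTransGen_swap.2 i2
      rcases Relation.ReflTransGen.total_of_right_unique hlu j1 j2 with k | k
      · exact Or.inr (Relation.reflTransGen_swap.1 k)
      · exact Or.inl (Relation.reflTransGen_swap.1 k)
    · exact Relation.ReflTransGen.total_of_right_unique hru i1 i2
    · exact Or.inr (i2.trans i1)

theorem rtg_le {x y : P} (h : Relation.ReflTransGen IsDInterval x y) : x ≤ y := by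
  induction h with
  | refl => exact le_rfl
  | tail _ h ih => exact ih.trans (R_lt h).le

theorem rtg_of (hP : IsDComplete P) {x y : P} (h : col x = col y) (hlt : x < y) :
    Relation.ReflTransGen IsDInterval x y := by
  rcases same_comp hP h with h | h
  · exact h
  · exact absurd (rtg_le h) hlt.not_ge

theorem same_up (hP : IsDComplete P) {x y : P} (h : col x = col y) (hlt : x < y) :
    ∃ t, IsDInterval x t ∧ t ≤ y := by
  rcases (rtg_of hP h hlt).cases_head with h | ⟨t, h1, h2⟩
  · exact absurd h hlt.ne
  · exact ⟨t, h1, rtg_le h2⟩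

theorem same_down (hP : IsDComplete P) {x y : P} (h : col x = col y) (hlt : x < y) :
    ∃ t, IsDInterval t y ∧ x ≤ t := by
  rcases (rtg_of hP h hlt).cases_tail with h | ⟨t, h1, h2⟩
  · exact absurd h hlt.ne'
  · exact ⟨t, h2, rtg_le h1⟩

theorem same_le (hP : IsDComplete P) {x y : P} (h : col x = col y) : x ≤ y ∨ y ≤ x := by
  rcases same_comp hP h with h | h
  · exact Or.inl (rtg_le h)
  · exact Or.inr (rtg_le h)

def Mid (r q u v : P) : Prop := u ≠ v ∧ r ⋖ u ∧ v ⋖ q ∧ r < v ∧ u < q ∧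
  (∀ x, r ⋖ x → x = u ∨ x = v) ∧
  ((r ⋖ v ∧ u ⋖ q ∧ ∀ x, x ⋖ q → x = u ∨ x = v) ∨ (IsDInterval u v ∧ ∀ x, x ⋖ q → x = v))

theorem mid_of_base (hP : IsDComplete P) {r q w z : P} (h : BaseD r q w z) : Mid r q w z := by
  obtain ⟨k1, k2, k3, k4, k5, k6, k7⟩ := h
  exact ⟨k1, k2, k5, k3.lt, k4.lt, fun x hx => L2 hP k2 k3 k1 hx, Or.inl ⟨k3, k4, k7⟩⟩

theorem mid_of_step (hP : IsDComplete P) {r q u v : P} (h : StepD r q u v) : Mid r q u v := by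
  have hu := step_unique hP h
  obtain ⟨k1, k2, k3, k4, k5⟩ := h
  exact ⟨(R_lt k1).ne, k2, k3, k2.lt.trans (R_lt k1), (R_lt k1).trans k3.lt,
    fun x hx => Or.inl (hu x hx), Or.inr ⟨k1, k5⟩⟩

theorem exists_mid (hP : IsDComplete P) {r q : P} (h : IsDInterval r q) : ∃ u v, Mid r q u v := by
  rcases R_cases hP h with ⟨w, z, h⟩ | ⟨u, v, h⟩
  · exact ⟨w, z, mid_of_base hP h⟩
  · exact ⟨u, v, mid_of_step hP h⟩

theorem col_cov (hP : IsDComplete P) {x y : P} (h : x ⋖ y) : col x ≠ col y := by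
  intro hc
  obtain ⟨t, h1, h2⟩ := same_up hP hc h.lt
  have hty : t = y := by
    by_contra hne
    exact h.2 (R_lt h1) (lt_of_le_of_ne h2 hne)
  subst hty
  obtain ⟨u, v, hm⟩ := exists_mid hP h1
  exact h.2 hm.2.1.lt hm.2.2.2.2.1

def Adj (F : Finset P) (i j : Quotient (diagSetoid P)) : Prop :=
  ∃ x ∈ F, ∃ y ∈ F, x ⋖ y ∧ ((col x = i ∧ col y = j) ∨ (col x = j ∧ col y = i))

theorem Adj.symm {F : Finset P} {i j : Quotient (diagSetoid P)} (h : Adj F i j) : Adj F j i := by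
  obtain ⟨x, hx, y, hy, h1, h2⟩ := h
  exact ⟨x, hx, y, hy, h1, h2.symm⟩

theorem Adj.irrefl (hP : IsDComplete P) {F : Finset P} {i j : Quotient (diagSetoid P)}
    (h : Adj F i j) : i ≠ j := by
  obtain ⟨x, hx, y, hy, h1, ⟨rfl, rfl⟩ | ⟨rfl, rfl⟩⟩ := h
  · exact col_cov hP h1
  · exact (col_cov hP h1).symm

theorem adj_cov {F : Finset P} {x y : P} (hx : x ∈ F) (hy : y ∈ F) (h : x ⋖ y) :
    Adj F (col x) (col y) := ⟨x, hx, y, hy, h, Or.inl ⟨rfl, rfl⟩⟩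

structure Hyp (F : Finset P) : Prop where
  h1 : ∀ x ∈ F, ∀ y ∈ F, Adj F (col x) (col y) → x ≤ y ∨ y ≤ x
  h3 : ∀ r ∈ F, ∀ q u v, IsDInterval r q → Mid r q u v → ∀ s, r < s → s < q →
    Adj F (col r) (col s) → s = u ∨ s = v
  h4 : ∀ r ∈ F, (¬ ∃ q, IsDInterval r q) → ∀ s s', r < s → r < s' → Adj F (col r) (col s) →
    Adj F (col r) (col s') → s = s'

theorem hyp_all (hP : IsDComplete P) : ∀ (n : ℕ) (F : Finset P), F.card = n →
    (∀ x ∈ F, ∀ y, x ≤ y → y ∈ F) → Hyp F := by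
  intro n
  induction n with
  | zero =>
    intro F hF _
    rw [Finset.card_eq_zero] at hF
    subst hF
    exact ⟨by simp, by simp, by simp⟩
  | succ n ih =>
    intro F hF hup
    have hne : F.Nonempty := by rw [← Finset.card_pos]; omega
    obtain ⟨p, hpF, hpmin⟩ := F.exists_minimal hne
    have hmin : ∀ y ∈ F, ¬ y < p := fun y hy hlt => hlt.not_ge (hpmin hy hlt.le)
    obtain ⟨F', hF'⟩ : ∃ F', F' = F.erase p := ⟨_, rfl⟩
    have memF' : ∀ x, x ∈ F' ↔ x ≠ p ∧ x ∈ F := by intro x; rw [hF', Finset.mem_erase]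
    have hup' : ∀ x ∈ F', ∀ y, x ≤ y → y ∈ F' := by
      intro x hx y hxy
      rw [memF'] at hx ⊢
      refine ⟨?_, hup x hx.2 y hxy⟩
      rintro rfl
      exact hmin x hx.2 (lt_of_le_of_ne hxy hx.1)
    have hH := ih F' (by rw [hF', Finset.card_erase_of_mem hpF]; omega) hup'
    have hpF' : p ∉ F' := by rw [memF']; exact fun h => h.1 rfl
    have hgt : ∀ y, p < y → y ∈ F' := fun y hy => by
      rw [memF']; exact ⟨hy.ne', hup p hpF y hy.le⟩
    have mono : ∀ i j, Adj F' i j → Adj F i j := by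
      rintro i j ⟨x, hx, y, hy, h⟩
      exact ⟨x, ((memF' x).1 hx).2, y, ((memF' y).1 hy).2, h⟩
    have newpair : ∀ x ∈ F, ∀ y ∈ F, x ⋖ y → (x ∈ F' ∧ y ∈ F') ∨ x = p := by
      intro x hx y hy hxy
      by_cases hxp : x = p
      · exact Or.inr hxp
      · refine Or.inl ⟨(memF' x).2 ⟨hxp, hx⟩, (memF' y).2 ⟨?_, hy⟩⟩
        rintro rfl
        exact hmin x hx hxy.lt
    by_cases hq : ∃ q, IsDInterval p q
    · obtain ⟨q, hq⟩ := hq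
      have hqF := hgt q (R_lt hq)
      have hadj : ∀ i j, Adj F i j → Adj F' i j := by
        obtain ⟨u, v, m1, m2, m3, m4, m5, m6, m7⟩ := exists_mid hP hq
        have huF := hgt u m2.lt
        have hvF := hgt v m4
        have a1 : Adj F' (col p) (col v) := by
          rw [col_R hq]; exact (adj_cov hvF hqF m3).symm
        have a2 : Adj F' (col p) (col u) := by
          rcases m7 with m7 | m7
          · rw [col_R hq]; exact (adj_cov huF hqF m7.2.1).symm
          · rw [col_R m7.1]; exact a1
        rintro i j ⟨x, hx, y, hy, h1, h2⟩
        rcases newpair x hx y hy h1 with ⟨k1, k2⟩ | rfl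
        · exact ⟨x, k1, y, k2, h1, h2⟩
        · have a3 : Adj F' (col x) (col y) := by
            rcases m6 y h1 with rfl | rfl
            · exact a2
            · exact a1
          rcases h2 with ⟨rfl, rfl⟩ | ⟨rfl, rfl⟩
          · exact a3
          · exact a3.symm
      have key : ∀ u v, Mid p q u v → ∀ s, s ∈ F' → s < q → Adj F' (col s) (col q) →
          s = u ∨ s = v := by
        rintro u v ⟨m1, m2, m3, m4, m5, m6, m7⟩ s
        have hlow : ∀ s, s ⋖ q → s = u ∨ s = v := by
          intro s hs
          rcases m7 with m7 | m7
          · exact m7.2.2 s hs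
          · exact Or.inr (m7.2 s hs)
        induction s using WellFoundedGT.induction with
        | ind s ihs =>
          intro hs hsq hA
          by_cases hR : ∃ t, IsDInterval s t
          · obtain ⟨t, hR⟩ := hR
            have htF := hup' s hs t (R_lt hR).le
            rw [col_R hR] at hA
            have hcov : ∀ x, p ⋖ x → ¬ IsDInterval s x := by
              intro x hx hsx
              have := hP.2.1 s x hsx p hx
              exact hpF' (hup' s hs p this.1)
            rcases hH.h1 t htF q hqF hA with h | h
            · have htq : t < q := by
                refine lt_of_le_of_ne h ?_
                rintro rfl
                exact Adj.irrefl hP hA rfl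
              rcases ihs t (R_lt hR) htF htq hA with rfl | rfl
              · exact absurd hR (hcov _ m2)
              · rcases m7 with m7 | m7
                · exact absurd hR (hcov _ m7.1)
                · exact Or.inl (left_unique hP hR m7.1)
            · have hqt : q < t := by
                refine lt_of_le_of_ne h ?_
                rintro rfl
                exact Adj.irrefl hP hA rfl
              obtain ⟨u', v', hm⟩ := exists_mid hP hR
              rw [← col_R hR] at hA
              rcases hH.h3 s hs t u' v' hR hm q hsq hqt hA with h | h
              · exact hlow s (h ▸ hm.2.1)
              · rcases hm.2.2.2.2.2.2 with m8 | m8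
                · exact hlow s (h ▸ m8.1)
                · exfalso
                  rw [← h] at m8
                  have := left_unique hP m8.1 hq
                  subst this
                  exact hpF' (hup' s hs _ hm.2.1.le)
          · obtain ⟨x, hx1, hx2⟩ := exists_covBy_le_of_lt hsq
            have := hH.h4 s hs hR x q hx1.lt hsq (adj_cov hs (hup' s hs x hx1.le) hx1) hA
            subst this
            exact hlow s hx1
      have keyp : ∀ y ∈ F, Adj F (col p) (col y) → p ≤ y := by
        intro y hy hA
        have hA := hadj _ _ hA
        have hyF : y ∈ F' := by
          rw [memF']; refine ⟨?_, hy⟩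
          rintro rfl
          exact Adj.irrefl hP hA rfl
        rw [col_R hq] at hA
        rcases hH.h1 q hqF y hyF hA with h | h
        · exact (R_lt hq).le.trans h
        · rcases h.lt_or_eq with h | h
          · obtain ⟨u, v, hm⟩ := exists_mid hP hq
            rcases key u v hm y hyF h hA.symm with rfl | rfl
            · exact hm.2.1.le
            · exact hm.2.2.2.1.le
          · rw [h]; exact (R_lt hq).le
      refine ⟨?_, ?_, ?_⟩
      · intro x hx y hy hA
        by_cases hxp : x = p
        · subst hxp
          exact Or.inl (keyp y hy hA)
        by_cases hyp : y = p
        · subst hyp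
          exact Or.inr (keyp x hx hA.symm)
        exact hH.h1 x ((memF' x).2 ⟨hxp, hx⟩) y ((memF' y).2 ⟨hyp, hy⟩) (hadj _ _ hA)
      · intro r hr q2 u v hR hm s h1 h2 hA
        have hA := hadj _ _ hA
        by_cases hrp : r = p
        · subst hrp
          have := right_unique hP hR hq
          subst this
          rw [col_R hR] at hA
          exact key u v hm s (hgt s h1) h2 hA.symm
        · exact hH.h3 r ((memF' r).2 ⟨hrp, hr⟩) q2 u v hR hm s h1 h2 hA
      · intro r hr hno s s' h1 h2 hA hA'
        have hrp : r ≠ p := by rintro rfl; exact hno ⟨q, hq⟩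
        exact hH.h4 r ((memF' r).2 ⟨hrp, hr⟩) hno s s' h1 h2 (hadj _ _ hA) (hadj _ _ hA')
    · have hnew : ∀ y ∈ F, col y = col p → y = p := by
        intro y hy hc
        by_contra hne
        rcases same_le hP hc with h | h
        · exact hmin y hy (lt_of_le_of_ne h hne)
        · obtain ⟨t, ht, _⟩ := same_up hP hc.symm (lt_of_le_of_ne h (Ne.symm hne))
          exact hq ⟨t, ht⟩
      have huniq : ∀ x y, p ⋖ x → p ⋖ y → x = y := by
        intro x y hx hy
        by_contra hne
        obtain ⟨t, ht, _⟩ := L1 hP hx hy hne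
        exact hq ⟨t, ht⟩
      have halone : ∀ x, p ⋖ x → ∀ b ∈ F, col b = col x → b = x := by
        intro x hx b hb hc
        by_contra hne
        rcases same_le hP hc with h | h
        · obtain ⟨t, ht, hbt⟩ := same_down hP hc (lt_of_le_of_ne h hne)
          have := hP.2.1 t x ht p hx
          have hbp : b = p := by
            by_contra hbp
            exact hmin b hb (lt_of_le_of_ne (hbt.trans this.1) hbp)
          subst hbp
          exact col_cov hP hx hc
        · obtain ⟨t, ht, _⟩ := same_up hP hc.symm (lt_of_le_of_ne h (Ne.symm hne))
          obtain ⟨q, hq', _⟩ := L1' hP hx (fun y hy => huniq y x hy hx) ht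
          exact hq ⟨q, hq'⟩
      have hadj : ∀ i j, i ≠ col p → j ≠ col p → Adj F i j → Adj F' i j := by
        rintro i j hi hj ⟨x, hx, y, hy, h1, h2⟩
        rcases newpair x hx y hy h1 with ⟨k1, k2⟩ | rfl
        · exact ⟨x, k1, y, k2, h1, h2⟩
        · rcases h2 with ⟨rfl, rfl⟩ | ⟨rfl, rfl⟩
          · exact absurd rfl hi
          · exact absurd rfl hj
      have hadjp : ∀ b ∈ F, Adj F (col p) (col b) → p ⋖ b := by
        rintro b hb ⟨x, hx, y, hy, h1, ⟨h2, h3⟩ | ⟨h2, h3⟩⟩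
        · have := hnew x hx h2
          subst this
          rw [halone y h1 b hb h3.symm]; exact h1
        · have := hnew y hy h3
          subst this
          exact absurd h1.lt (hmin x hx)
      have hcol : ∀ r ∈ F, r ≠ p → col r ≠ col p := fun r hr hne hc => hne (hnew r hr hc)
      refine ⟨?_, ?_, ?_⟩
      · intro x hx y hy hA
        by_cases hxp : x = p
        · subst hxp
          exact Or.inl (hadjp y hy hA).le
        by_cases hyp : y = p
        · subst hyp
          exact Or.inr (hadjp x hx hA.symm).le
        exact hH.h1 x ((memF' x).2 ⟨hxp, hx⟩) y ((memF' y).2 ⟨hyp, hy⟩)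
          (hadj _ _ (hcol x hx hxp) (hcol y hy hyp) hA)
      · intro r hr q2 u v hR hm s h1 h2 hA
        have hrp : r ≠ p := by rintro rfl; exact hq ⟨q2, hR⟩
        have hsF := hup r hr s h1.le
        have hsp : s ≠ p := by rintro rfl; exact hmin r hr h1
        exact hH.h3 r ((memF' r).2 ⟨hrp, hr⟩) q2 u v hR hm s h1 h2
          (hadj _ _ (hcol r hr hrp) (hcol s hsF hsp) hA)
      · intro r hr hno s s' h1 h2 hA hA'
        have hsF := hup r hr s h1.le
        have hsF' := hup r hr s' h2.le
        by_cases hrp : r = p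
        · subst hrp
          exact huniq _ _ (hadjp s hsF hA) (hadjp s' hsF' hA')
        · have hsp : s ≠ p := by rintro rfl; exact hmin r hr h1
          have hsp' : s' ≠ p := by rintro rfl; exact hmin r hr h2
          exact hH.h4 r ((memF' r).2 ⟨hrp, hr⟩) hno s s' h1 h2
            (hadj _ _ (hcol r hr hrp) (hcol s hsF hsp) hA)
            (hadj _ _ (hcol r hr hrp) (hcol s' hsF' hsp') hA')

theorem hyp_univ (hP : IsDComplete P) : Hyp (Finset.univ : Finset P) :=
  hyp_all hP _ _ rfl (by simp)

noncomputable def am (i j : Quotient (diagSetoid P)) : ℤ :=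
  if i = j then 2 else if Adj (Finset.univ : Finset P) i j then -1 else 0

theorem am_symm (i j : Quotient (diagSetoid P)) : am i j = am j i := by
  have : Adj (Finset.univ : Finset P) i j ↔ Adj (Finset.univ : Finset P) j i :=
    ⟨Adj.symm, Adj.symm⟩
  simp only [am, this, eq_comm]

theorem am_adj (hP : IsDComplete P) {i j : Quotient (diagSetoid P)}
    (h : Adj (Finset.univ : Finset P) i j) : am i j = -1 := by
  rw [am, if_neg (Adj.irrefl hP h), if_pos h]

theorem am_zero {i j : Quotient (diagSetoid P)} (h1 : i ≠ j)
    (h : ¬ Adj (Finset.univ : Finset P) i j) : am i j = 0 := by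
  rw [am, if_neg h1, if_neg h]

theorem am_comp (hP : IsDComplete P) {x y : P} (h : am (col x) (col y) ≠ 0) : x ≤ y ∨ y ≤ x := by
  by_cases h1 : col x = col y
  · exact same_le hP h1
  · by_cases h2 : Adj (Finset.univ : Finset P) (col x) (col y)
    · exact (hyp_univ hP).h1 x (by simp) y (by simp) h2
    · exact absurd (am_zero h1 h2) h

/-- the values of the Cartan form on an interval -/
theorem am_mid (hP : IsDComplete P) {r q u v : P} (hR : IsDInterval r q) (hm : Mid r q u v) (s : P)
    (hs1 : r < s) (hs2 : s < q) :
    am (col s) (col r) = if s = u ∨ s = v then -1 else 0 := by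
  have a1 : Adj Finset.univ (col v) (col r) := by
    rw [col_R hR]; exact adj_cov (by simp) (by simp) hm.2.2.1
  have a2 : Adj Finset.univ (col u) (col r) := (adj_cov (by simp) (by simp) hm.2.1).symm
  split_ifs with h
  · rcases h with rfl | rfl
    · exact am_adj hP a2
    · exact am_adj hP a1
  · apply am_zero
    · intro hc
      obtain ⟨t, ht, hts⟩ := same_up hP hc.symm hs1
      rw [right_unique hP ht hR] at hts
      exact hs2.not_ge hts
    · intro hA
      exact h ((hyp_univ hP).h3 r (by simp) q u v hR hm s hs1 hs2 hA.symm)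

noncomputable def gK (p : P) : ℤ := 1 + ∑ q with p < q, am (col q) (col p)

theorem gK_R (hP : IsDComplete P) {p q : P} (hR : IsDInterval p q) : gK p = gK q := by
  obtain ⟨u, v, hm⟩ := exists_mid hP hR
  obtain ⟨m1, m2, m3, m4, m5, m6, m7⟩ := id hm
  rw [gK, gK]
  congr 1
  have e : ∀ s : P, (if p < s then am (col s) (col p) else 0)
      = (if q < s then am (col s) (col q) else 0) + (if s = q then 2 else 0)
        + (if s = u then -1 else 0) + (if s = v then -1 else 0) := by
    intro s
    by_cases hsq : s = q
    · subst hsq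
      simp [R_lt hR, col_R hR, am, m5.ne', m3.lt.ne']
    by_cases h1 : q < s
    · have h2 : s ≠ u := by rintro rfl; exact lt_asymm h1 m5
      have h3 : s ≠ v := by rintro rfl; exact lt_asymm h1 m3.lt
      simp [h1, (R_lt hR).trans h1, hsq, h2, h3, col_R hR]
    by_cases h2 : p < s
    · by_cases h3 : s < q
      · rw [if_pos h2, am_mid hP hR hm s h2 h3, if_neg h1, if_neg hsq]
        by_cases h4 : s = u
        · have : s ≠ v := by rintro rfl; exact m1 h4.symm
          simp [h4, m1]
        · by_cases h5 : s = v
          · simp [h5, m1.symm]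
          · simp [h4, h5]
      · have h4 : am (col s) (col p) = 0 := by
          by_contra h0
          rw [col_R hR] at h0
          rcases am_comp hP h0 with h | h
          · exact h3 (lt_of_le_of_ne h hsq)
          · exact h1 (lt_of_le_of_ne h (Ne.symm hsq))
        have h5 : s ≠ u := by rintro rfl; exact h3 m5
        have h6 : s ≠ v := by rintro rfl; exact h3 m3.lt
        simp [h4, h1, hsq, h5, h6]
    · have h5 : s ≠ u := by rintro rfl; exact h2 m2.lt
      have h6 : s ≠ v := by rintro rfl; exact h2 m4
      simp [h2, h1, hsq, h5, h6]
  rw [Finset.sum_filter, Finset.sum_filter, Finset.sum_congr rfl (fun s _ => e s),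
    Finset.sum_add_distrib, Finset.sum_add_distrib, Finset.sum_add_distrib,
    Finset.sum_ite_eq', Finset.sum_ite_eq', Finset.sum_ite_eq']
  simp only [Finset.mem_univ, if_true]
  ring

theorem gK_eqv (hP : IsDComplete P) {p q : P} (h : DiagRel p q) : gK p = gK q := by
  have hE : Relation.EqvGen (fun x y => IsDInterval x y) p q := h
  clear h
  induction hE with
  | rel x y hxy => exact gK_R hP hxy
  | refl x => rfl
  | symm x y _ ih => exact ih.symm
  | trans x y z h1 h2 ih1 ih2 => exact ih1.trans ih2

theorem gK_nonneg (hP : IsDComplete P) (p : P) : 0 ≤ gK p := by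
  induction p using WellFoundedGT.induction with
  | ind p ih =>
    by_cases hR : ∃ q, IsDInterval p q
    · obtain ⟨q, hR⟩ := hR
      rw [gK_R hP hR]; exact ih q (R_lt hR)
    · have hne : ∀ s, p < s → col s ≠ col p := by
        intro s hs hc
        obtain ⟨t, ht, _⟩ := same_up hP hc.symm hs
        exact hR ⟨t, ht⟩
      rw [gK]
      by_cases hs : ∃ s, p < s ∧ Adj Finset.univ (col p) (col s)
      · obtain ⟨s, hs1, hs2⟩ := hs
        rw [Finset.sum_eq_single s]
        · rw [am_adj hP hs2.symm]; norm_num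
        · intro t ht hts
          simp at ht
          apply am_zero (hne t ht)
          intro hA
          exact hts ((hyp_univ hP).h4 p (by simp) hR t s ht hs1 hA.symm hs2)
        · intro h; simp [hs1] at h
      · rw [Finset.sum_eq_zero]
        · norm_num
        · intro t ht
          simp at ht
          apply am_zero (hne t ht)
          exact fun hA => hs ⟨t, ht, hA.symm⟩

noncomputable def lamq (hP : IsDComplete P) : Quotient (diagSetoid P) → ℤ :=
  Quotient.lift gK (fun _ _ h => gK_eqv hP h)

theorem dheap (hP : IsDComplete P) : DHeap (P := P) col am (lamq hP) where
  symm := am_symm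
  diag i := by simp [am]
  off i j h := by
    by_cases h1 : Adj (Finset.univ : Finset P) i j
    · exact Or.inr (am_adj hP h1)
    · exact Or.inl (am_zero h h1)
  comp x y h := am_comp hP h
  cov x y h := am_adj hP (adj_cov (by simp) (by simp) h)
  K p := rfl
  nonneg i := by
    induction i using Quotient.inductionOn with
    | h p => exact gK_nonneg hP p
end DC

namespace DC
variable {P : Type*} [PartialOrder P] [Fintype P]

theorem neck_of_DI {k : ℕ} {r q w z p : P} (h : DI k r q w z) :
    p ∈ Set.Icc r q → w ≤ p → z ≤ p → ∃ p', IsDInterval p' p := by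
  induction h with
  | @base r q w z h1 h2 h3 h4 h5 h6 =>
    intro hp hw hz
    have f := (DI.base h1 h2 h3 h4 h5 h6).facts
    obtain ⟨_, f1, f2, f3, f4, f5, f6⟩ := f
    rw [h6] at hp
    rcases hp with hp | hp | hp | hp
    · subst hp; exact absurd hw f1.not_ge
    · subst hp; exact absurd hz f6
    · subst hp; exact absurd hw f5
    · subst hp; exact ⟨r, iff_DI.2 ⟨_, _, _, DI.base h1 h2 h3 h4 h5 h6⟩⟩
  | @step k r q u v w z hd h1 h2 h3 ih =>
    intro hp hw hz
    have f := (DI.step hd h1 h2 h3).facts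
    rw [h3] at hp
    rcases hp with hp | hp | hp
    · subst hp; exact absurd hw f.2.1.not_ge
    · subst hp; exact ⟨r, iff_DI.2 ⟨_, _, _, DI.step hd h1 h2 h3⟩⟩
    · exact ih hp hw hz

theorem neck_of {p a b : P} (h : IsNeckOf p a b) : ∃ p', IsDInterval p' p := by
  obtain ⟨k, w, z, h1, h2, h3, h4⟩ := h
  exact neck_of_DI (DI.of_k k h1) h2 h3 h4

theorem hook_mid (hP : IsDComplete P) (h : P → Quotient (diagSetoid P) → ℤ)
    (hh : IsHookVector h) {r q : P} (hR : IsDInterval r q) :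
    ∃ u v, Mid r q u v ∧ ∀ D, h q D = h u D + h v D - h r D := by
  obtain ⟨k, w, z, hd⟩ := iff_DI.1 hR
  have hd0 := hd
  cases hd with
  | base h1 h2 h3 h4 h5 h6 =>
    refine ⟨w, z, mid_of_base hP (DI_base hP h1 h2 h3 h4 h5 h6), fun D => ?_⟩
    exact hh.2 _ _ _ _ ⟨_, hd0.to_k⟩ D
  | @step k _ _ u v _ _ hd h1 h2 h3 =>
    refine ⟨u, v, mid_of_step hP (DI_step hP hd h1 h2 h3), fun D => ?_⟩
    have e1 := hh.2 _ _ _ _ ⟨_, hd0.to_k⟩ D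
    have e2 := hh.2 _ _ _ _ ⟨_, hd.to_k⟩ D
    linarith

theorem neck_sum (hP : IsDComplete P) {p q u v : P} (hR : IsDInterval p q) (hm : Mid p q u v)
    (g : P → ℤ) : ∑ s with s < q, am (col s) (col q) * g s
      = (∑ s with s < p, am (col s) (col p) * g s) + 2 * g p - g u - g v := by
  obtain ⟨m1, m2, m3, m4, m5, m6, m7⟩ := id hm
  have e : ∀ s : P, (if s < q then am (col s) (col q) * g s else 0)
      = (if s < p then am (col s) (col p) * g s else 0) + (if s = p then 2 * g s else 0)
        + (if s = u then - g s else 0) + (if s = v then - g s else 0) := by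
    intro s
    rw [← col_R hR]
    by_cases hsp : s = p
    · subst hsp
      simp [R_lt hR, am, m4.ne, m2.lt.ne]
    by_cases h1 : s < p
    · have h2 : s ≠ u := by rintro rfl; exact lt_asymm h1 m2.lt
      have h3 : s ≠ v := by rintro rfl; exact lt_asymm h1 m4
      simp [h1, h1.trans (R_lt hR), hsp, h2, h3]
    by_cases h2 : s < q
    · by_cases h3 : p < s
      · rw [if_pos h2, am_mid hP hR hm s h3 h2, if_neg h1, if_neg hsp]
        by_cases h4 : s = u
        · simp [h4, m1]
        · by_cases h5 : s = v
          · simp [h5, m1.symm]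
          · simp [h4, h5]
      · have h4 : am (col s) (col p) = 0 := by
          by_contra h0
          rcases am_comp hP h0 with h | h
          · exact h1 (lt_of_le_of_ne h hsp)
          · exact h3 (lt_of_le_of_ne h (Ne.symm hsp))
        have h5 : s ≠ u := by rintro rfl; exact h3 m2.lt
        have h6 : s ≠ v := by rintro rfl; exact h3 m4
        simp [h4, h1, hsp, h5, h6]
    · have h5 : s ≠ u := by rintro rfl; exact h2 m5
      have h6 : s ≠ v := by rintro rfl; exact h2 m3.lt
      simp [h2, h1, hsp, h5, h6]
  rw [Finset.sum_filter, Finset.sum_filter, Finset.sum_congr rfl (fun s _ => e s),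
    Finset.sum_add_distrib, Finset.sum_add_distrib, Finset.sum_add_distrib,
    Finset.sum_ite_eq', Finset.sum_ite_eq', Finset.sum_ite_eq']
  simp only [Finset.mem_univ, if_true]
  ring

theorem hook_rec (hP : IsDComplete P) (h : P → Quotient (diagSetoid P) → ℤ)
    (hh : IsHookVector h) (p : P) :
    (∑ D, h p D) = 1 - ∑ s with s < p, am (col s) (col p) * ∑ D, h s D := by
  induction p using WellFoundedLT.induction with
  | ind p ih =>
    by_cases hR : ∃ p', IsDInterval p' p
    · obtain ⟨p', hR⟩ := hR
      obtain ⟨u, v, hm, hD⟩ := hook_mid hP h hh hR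
      rw [neck_sum hP hR hm (fun s => ∑ D, h s D), Finset.sum_congr rfl (fun D _ => hD D),
        Finset.sum_sub_distrib, Finset.sum_add_distrib]
      have := ih p' (R_lt hR)
      linarith
    · have hn : ¬ ∃ a b : P, IsNeckOf p a b := by
        rintro ⟨a, b, hab⟩
        exact hR (neck_of hab)
      have hlow : ∀ s, s < p → col s ≠ col p := by
        intro s hs hc
        obtain ⟨t, ht, _⟩ := same_down hP hc hs
        exact hR ⟨t, ht⟩
      rw [← (dheap hP).hook_nonneck (fun s => ∑ D, h s D) p hlow ih,
        Finset.sum_congr rfl (fun D _ => hh.1 p hn D)]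
      rw [Finset.card_eq_sum_card_fiberwise (f := col) (t := Finset.univ) (by intro x _; simp)]
      push_cast
      refine Finset.sum_congr rfl fun D _ => ?_
      congr 1
      rw [Set.ncard_eq_toFinset_card']
      congr 1
      ext x
      rw [Set.mem_toFinset]
      constructor
      · intro hx
        exact Finset.mem_filter.2 ⟨Finset.mem_filter.2 ⟨Finset.mem_univ _, hx.2⟩, hx.1⟩
      · intro hx
        exact ⟨(Finset.mem_filter.1 hx).2, (Finset.mem_filter.1 (Finset.mem_filter.1 hx).1).2⟩

theorem main (hP : IsDComplete P) (h : P → Quotient (diagSetoid P) → ℤ)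
    (hh : IsHookVector h) :
    ((Finset.univ.filter
        (fun e : Fin (Fintype.card P) ≃ P => IsLinExt e)).card : ℚ)
      = (Nat.factorial (Fintype.card P) : ℚ) /
          ∏ p : P, ∑ D : Quotient (diagSetoid P), (h p D : ℚ) := by
  have e1 := (dheap hP).count_LE (fun s => ∑ D, h s D) (hook_rec hP h hh)
  rw [← DHeap.card_linExt] at e1
  push_cast at e1
  have hne : (∏ p : P, ∑ D : Quotient (diagSetoid P), (h p D : ℚ)) ≠ 0 := by
    intro h0
    rw [h0, mul_zero] at e1
    exact (Nat.cast_ne_zero.2 (Nat.factorial_ne_zero _)) e1.symm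
  rw [eq_div_iff hne, ← e1]
  congr 3
  ext e
  rw [Finset.mem_filter, Finset.mem_filter]
  exact Iff.rfl
end DC

/-- Proctor's hook length formula for d-complete posets: the number of linear
extensions of `P` equals `n!` divided by the product over `p ∈ P` of the hook
lengths `∑_D h_P^{(D)}(p)`. -/
theorem hook_length_formula {P : Type*} [PartialOrder P] [Fintype P]
    (hP : IsDComplete P) (h : P → Quotient (diagSetoid P) → ℤ)
    (hh : IsHookVector h) :
    ((Finset.univ.filter
        (fun e : Fin (Fintype.card P) ≃ P => IsLinExt e)).card : ℚ)
      = (Nat.factorial (Fintype.card P) : ℚ) /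
          ∏ p : P, ∑ D : Quotient (diagSetoid P), (h p D : ℚ) := by
  exact DC.main hP h hh
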